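/- arXiv:1309.2042 — 2 statements merged into one kernel-verified Lean document; each statement's English description precedes it below -/
import Mathlib

section
/- Let N ≥ 3 and a_1 > a_2 > ... > a_N > 0, and let V be the equilibrium potential of the ellipsoid Ω = {x : Σ_{j=1}^N x_j²/a_j² ≤ 1}, given by V(x) = (1/B)(μ̂(x) − (1/2) Σ_{i=1}^N x_i·(∂μ̂/∂x_i)(x)) with B = C_N ∫_Ω |y|^{2−N} dy and μ̂(x) = C_N ∫_E |x−y|^{2−N} dμ(y). Then for every λ > 0, V is constant on the confocal ellipsoid Γ_λ = {x ∈ ℝ^N : Σ_{j=1}^N x_j²/(a_j² + λ) = 1}; that is, the equipotential surfaces of V are the ellipsoids confocal with ∂Ω. -/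
open MeasureTheory

open Metric Set

theorem measurableSet_shell {E : Type*} [NormedAddCommGroup E] [MeasurableSpace E]
    [BorelSpace E] (c r : ℝ) : MeasurableSet {u : E | c < ‖u‖ ∧ ‖u‖ < r} :=
  (measurableSet_lt measurable_const measurable_norm).inter
    (measurableSet_lt measurable_norm measurable_const)

section Polar
variable {E : Type*} [NormedAddCommGroup E] [NormedSpace ℝ E] [MeasurableSpace E] [BorelSpace E]
  [FiniteDimensional ℝ E] (μ : Measure E) [μ.IsAddHaarMeasure]

theorem integral_volumeIoiPow (n : ℕ) (h : ℝ → ℝ) :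
    ∫ s : Ioi (0 : ℝ), h s ∂Measure.volumeIoiPow n = ∫ s in Ioi (0 : ℝ), s ^ n * h s := by
  simp only [Measure.volumeIoiPow, ENNReal.ofReal]
  rw [integral_withDensity_eq_integral_smul
    ((measurable_subtype_coe.pow_const _).real_toNNReal),
    integral_subtype_comap measurableSet_Ioi fun a ↦ Real.toNNReal (a ^ n) • h a]
  refine setIntegral_congr_fun measurableSet_Ioi fun x hx ↦ ?_
  simp only [NNReal.smul_def, Real.coe_toNNReal _ (pow_nonneg (mem_Ioi.1 hx).le _), smul_eq_mul]

theorem integrable_polar {f : E → ℝ} (hf : Integrable f μ) :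
    Integrable (fun p : sphere (0 : E) 1 × Ioi (0 : ℝ) ↦ f (p.2.1 • p.1.1))
      (μ.toSphere.prod (.volumeIoiPow (Module.finrank ℝ E - 1))) := by
  have := (μ.measurePreserving_homeomorphUnitSphereProd.integrable_comp_emb
    (Homeomorph.measurableEmbedding _)
    (g := fun p : sphere (0 : E) 1 × Ioi (0 : ℝ) ↦ f (p.2.1 • p.1.1))).1 ?_
  · exact this
  · have h2 : IntegrableOn f {0}ᶜ μ := hf.integrableOn
    rw [integrableOn_iff_comap_subtypeVal (by measurability)] at h2
    refine h2.congr (.of_forall fun x ↦ ?_)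
    simp only [Function.comp]
    congr 1
    have := congrArg Subtype.val ((homeomorphUnitSphereProd E).symm_apply_apply x)
    rw [homeomorphUnitSphereProd_symm_apply_coe] at this
    exact this.symm

theorem integrableOn_shell {f : E → ℝ} {c q r : ℝ}
    (hf : ContinuousOn f {u | c ≤ ‖u‖ ∧ ‖u‖ ≤ q}) (hr : r ≤ q) :
    IntegrableOn f {u | c < ‖u‖ ∧ ‖u‖ < r} μ := by
  have hK : IsCompact {u : E | c ≤ ‖u‖ ∧ ‖u‖ ≤ q} := by
    refine (isCompact_closedBall (0 : E) q).of_isClosed_subset ?_ fun u hu ↦ by simpa using hu.2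
    exact (isClosed_le continuous_const continuous_norm).inter
      (isClosed_le continuous_norm continuous_const)
  exact (hf.integrableOn_compact hK).mono_set fun u hu ↦ ⟨hu.1.le, hu.2.le.trans hr⟩

variable [Nontrivial E]

theorem integral_eq_integral_polar (f : E → ℝ) :
    ∫ x, f x ∂μ = ∫ p : sphere (0 : E) 1 × Ioi (0 : ℝ), f (p.2.1 • p.1.1)
      ∂(μ.toSphere.prod (.volumeIoiPow (Module.finrank ℝ E - 1))) := by
  have hpolar := μ.measurePreserving_homeomorphUnitSphereProd.integral_comp
    (homeomorphUnitSphereProd E).measurableEmbedding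
    (fun p : sphere (0 : E) 1 × Ioi (0 : ℝ) ↦ f (p.2.1 • p.1.1))
  have hsub := integral_subtype_comap (μ := μ) (measurableSet_singleton (0 : E)).compl f
  rw [restrict_compl_singleton] at hsub
  rw [← hpolar, ← hsub]
  refine integral_congr_ae (.of_forall fun x ↦ ?_)
  simp only
  congr 1
  have := congrArg Subtype.val ((homeomorphUnitSphereProd E).symm_apply_apply x)
  rw [homeomorphUnitSphereProd_symm_apply_coe] at this
  exact this.symm

theorem integral_eq_integral_sphere_integral {f : E → ℝ} (hf : Integrable f μ) :
    ∫ x, f x ∂μ = ∫ θ : sphere (0 : E) 1, ∫ s in Ioi (0 : ℝ),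
      s ^ (Module.finrank ℝ E - 1) * f (s • θ.1) ∂volume ∂μ.toSphere := by
  rw [integral_eq_integral_polar, integral_prod _ (integrable_polar μ hf)]
  exact integral_congr_ae (.of_forall fun θ ↦
    integral_volumeIoiPow _ fun s ↦ f (s • θ.1))

theorem integral_eq_integral_integral_sphere {f : E → ℝ} (hf : Integrable f μ) :
    ∫ x, f x ∂μ = ∫ s in Ioi (0 : ℝ), s ^ (Module.finrank ℝ E - 1) *
      ∫ θ : sphere (0 : E) 1, f (s • θ.1) ∂μ.toSphere := by
  rw [integral_eq_integral_polar, integral_prod_symm _ (integrable_polar μ hf)]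
  exact integral_volumeIoiPow _ fun s ↦ ∫ θ : sphere (0 : E) 1, f (s • θ.1) ∂μ.toSphere

theorem hasDerivAt_integral_shell {f : E → ℝ} {c q : ℝ} (hc : c < 1) (hq : 1 < q)
    (hf : ContinuousOn f {u | c ≤ ‖u‖ ∧ ‖u‖ ≤ q}) :
    HasDerivAt (fun r ↦ ∫ u in {u : E | c < ‖u‖ ∧ ‖u‖ < r}, f u ∂μ)
      (∫ θ : sphere (0 : E) 1, f θ.1 ∂μ.toSphere) 1 := by
  set d := Module.finrank ℝ E - 1
  set c' := max c 0
  have hc' : c' < 1 := max_lt hc one_pos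
  set g : ℝ → ℝ := fun s ↦ s ^ d * ∫ θ : sphere (0 : E) 1, f (s • θ.1) ∂μ.toSphere
  have hg : ContinuousOn g (Icc c' q) := by
    refine (continuousOn_id.pow d).mul ?_
    rw [continuousOn_iff_continuous_domRestrict]
    have hcont : Continuous fun p : Icc c' q × sphere (0 : E) 1 ↦ f (p.1.1 • p.2.1) := by
      refine hf.comp_continuous (by fun_prop) fun p ↦ ?_
      have h1 := p.1.2.1
      have h0 : 0 ≤ p.1.1 := (le_max_right _ _).trans h1
      have : ‖p.1.1 • p.2.1‖ = p.1.1 := by simp [norm_smul, abs_of_nonneg h0]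
      exact ⟨by rw [this]; exact (le_max_left _ _).trans h1, by rw [this]; exact p.1.2.2⟩
    have := continuous_parametric_integral_of_continuous (μ := μ.toSphere)
      (f := fun (s : Icc c' q) (θ : sphere (0 : E) 1) ↦ f (s.1 • θ.1)) hcont isCompact_univ
    simpa only [Measure.restrict_univ] using! this
  have hgI : IntervalIntegrable g volume c' 1 :=
    (hg.mono (by rw [uIcc_of_le hc'.le]; exact Icc_subset_Icc le_rfl hq.le)).intervalIntegrable
  have hnhds : Icc c' q ∈ nhds (1 : ℝ) := Icc_mem_nhds hc' hq
  have hderiv := intervalIntegral.integral_hasDerivAt_right hgI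
    (hg.mono Ioo_subset_Icc_self |>.stronglyMeasurableAtFilter isOpen_Ioo 1 ⟨hc', hq⟩)
    (hg.continuousAt hnhds)
  have hg1 : g 1 = ∫ θ : sphere (0 : E) 1, f θ.1 ∂μ.toSphere := by simp [g]
  rw [hg1] at hderiv
  refine hderiv.congr_of_eventuallyEq ?_
  filter_upwards [hnhds] with r hr
  rw [← integral_indicator (measurableSet_shell c r), integral_eq_integral_integral_sphere μ
    ((integrableOn_shell μ hf hr.2).integrable_indicator (measurableSet_shell c r)),
    intervalIntegral.integral_of_le hr.1, integral_Ioc_eq_integral_Ioo,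
    ← integral_indicator measurableSet_Ioo, ← integral_indicator measurableSet_Ioi]
  refine integral_congr_ae (.of_forall fun s ↦ ?_)
  simp only [indicator, mem_Ioi, mem_Ioo, mem_ofPred_eq, norm_smul, norm_eq_of_mem_sphere, mul_one,
    Real.norm_eq_abs, c', max_lt_iff]
  by_cases hs : 0 < s
  · by_cases h2 : c < s ∧ s < r
    · simp [hs, h2, abs_of_pos hs, g, d]
    · have h3 : ¬ ((c < s ∧ 0 < s) ∧ s < r) := by tauto
      simp only [abs_of_pos hs, h2, h3, if_false, mul_zero, integral_zero, ite_self]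
  · simp [hs]

end Polar

section Newton
variable {E : Type*} [NormedAddCommGroup E] [InnerProductSpace ℝ E]

open scoped RealInnerProductSpace

/-- The distance from `-w` to the sphere of radius `t` in the direction `θ`. -/
noncomputable def exitRadius (w : E) (t : ℝ) (θ : E) : ℝ :=
  -⟪w, θ⟫ + √(⟪w, θ⟫ ^ 2 + t ^ 2 - ‖w‖ ^ 2)

theorem exitRadius_pos {w θ : E} {t : ℝ} (ht : ‖w‖ < t) : 0 < exitRadius w t θ := by
  have h : ‖w‖ ^ 2 < t ^ 2 := by gcongr
  have : |⟪w, θ⟫| < √(⟪w, θ⟫ ^ 2 + t ^ 2 - ‖w‖ ^ 2) := by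
    rw [← Real.sqrt_sq_eq_abs]
    exact Real.sqrt_lt_sqrt (sq_nonneg _) (by linarith)
  have := le_abs_self ⟪w, θ⟫
  unfold exitRadius
  linarith

theorem norm_smul_add_sq {w θ : E} (hθ : ‖θ‖ = 1) {t : ℝ} (ht : ‖w‖ < t) (s : ℝ) :
    ‖s • θ + w‖ ^ 2 - t ^ 2 =
      (s - exitRadius w t θ) * (s + ⟪w, θ⟫ + √(⟪w, θ⟫ ^ 2 + t ^ 2 - ‖w‖ ^ 2)) := by
  have h : ‖w‖ ^ 2 < t ^ 2 := by gcongr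
  have hsq : √(⟪w, θ⟫ ^ 2 + t ^ 2 - ‖w‖ ^ 2) ^ 2 = ⟪w, θ⟫ ^ 2 + t ^ 2 - ‖w‖ ^ 2 :=
    Real.sq_sqrt (by nlinarith [sq_nonneg ⟪w, θ⟫])
  rw [norm_add_sq_real, norm_smul, hθ, inner_smul_left, real_inner_comm, mul_one,
    Real.norm_eq_abs, sq_abs]
  simp only [exitRadius, RCLike.conj_to_real]
  linear_combination hsq

theorem norm_smul_add_cmp {w θ : E} (hθ : ‖θ‖ = 1) {t : ℝ} (ht : ‖w‖ < t) {s : ℝ}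
    (hs : 0 < s) :
    (‖s • θ + w‖ < t ↔ s < exitRadius w t θ) ∧ (t < ‖s • θ + w‖ ↔ exitRadius w t θ < s) := by
  have key := norm_smul_add_sq hθ ht s
  have hpos : 0 < s + ⟪w, θ⟫ + √(⟪w, θ⟫ ^ 2 + t ^ 2 - ‖w‖ ^ 2) := by
    have := exitRadius_pos (w := -w) (θ := θ) (t := t) (by simpa)
    simp only [exitRadius, inner_neg_left, neg_neg, norm_neg, neg_sq] at this
    linarith
  have ht0 : 0 ≤ t := (norm_nonneg w).trans ht.le
  rw [← sq_lt_sq₀ (norm_nonneg _) ht0, ← sq_lt_sq₀ ht0 (norm_nonneg _)]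
  refine ⟨?_, ?_⟩
  · rw [← sub_neg, key, ← sub_neg (a := s), mul_neg_iff]
    constructor
    · rintro (h | h)
      · linarith
      · exact h.1
    · exact fun h ↦ .inr ⟨h, hpos⟩
  · rw [← sub_pos, key, ← sub_pos (a := s), mul_pos_iff_of_pos_right hpos]

theorem exitRadius_mono {w θ : E} {c r : ℝ} (hc : ‖w‖ < c) (hcr : c ≤ r) :
    exitRadius w c θ ≤ exitRadius w r θ := by
  have : 0 ≤ c := (norm_nonneg w).trans hc.le
  unfold exitRadius
  gcongr

theorem exitRadius_sq_add {w θ : E} {t : ℝ} (ht : ‖w‖ < t) :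
    exitRadius w t θ ^ 2 + exitRadius (-w) t θ ^ 2 = 4 * ⟪w, θ⟫ ^ 2 + 2 * (t ^ 2 - ‖w‖ ^ 2) := by
  have h : ‖w‖ ^ 2 < t ^ 2 := by gcongr
  have hsq : √(⟪w, θ⟫ ^ 2 + t ^ 2 - ‖w‖ ^ 2) ^ 2 = ⟪w, θ⟫ ^ 2 + t ^ 2 - ‖w‖ ^ 2 :=
    Real.sq_sqrt (by nlinarith [sq_nonneg ⟪w, θ⟫])
  simp only [exitRadius, inner_neg_left, neg_neg, norm_neg, neg_sq]
  linear_combination 2 * hsq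

theorem continuousOn_shift {E : Type*} [NormedAddCommGroup E] {k : E → ℝ}
    (hk :
    ContinuousOn k {0}ᶜ) {w : E} {c : ℝ} (q : ℝ) (hc : ‖w‖ < c) : ContinuousOn (fun u ↦ k (u - w)) {u | c ≤ ‖u‖ ∧ ‖u‖ ≤ q} := by
  refine hk.comp (by fun_prop) fun u hu ↦ ?_
  simp only [mem_compl_iff, mem_singleton_iff, sub_eq_zero]
  rintro rfl
  exact (hc.trans_le hu.1).false

variable [MeasurableSpace E] [BorelSpace E] [FiniteDimensional ℝ E] [Nontrivial E]
  (μ : Measure E) [μ.IsAddHaarMeasure]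

theorem integral_shell_shift {k : E → ℝ} (hk : ContinuousOn k {0}ᶜ)
    (hhom : ∀ s > 0, ∀ v, s ^ (Module.finrank ℝ E - 1) * k (s • v) = s * k v)
    {w : E} {c r : ℝ} (hc : ‖w‖ < c) (hcr : c ≤ r) :
    ∫ u in {u : E | c < ‖u‖ ∧ ‖u‖ < r}, k (u - w) ∂μ =
      ∫ θ : sphere (0 : E) 1, k θ.1 * ((exitRadius w r θ.1 ^ 2 - exitRadius w c θ.1 ^ 2) / 2)
        ∂μ.toSphere := by
  have hint := (integrableOn_shell μ (continuousOn_shift hk r hc) le_rfl).integrable_indicator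
    (measurableSet_shell c r)
  rw [← integral_indicator (measurableSet_shell c r), ← integral_add_right_eq_self _ w,
    integral_eq_integral_sphere_integral μ (hint.comp_add_right w)]
  refine integral_congr_ae (.of_forall fun θ ↦ ?_)
  have hθ : ‖θ.1‖ = 1 := norm_eq_of_mem_sphere θ
  simp only
  have hpow : ∫ s in Ioo (exitRadius w c θ.1) (exitRadius w r θ.1), k θ.1 * s =
      k θ.1 * ((exitRadius w r θ.1 ^ 2 - exitRadius w c θ.1 ^ 2) / 2) := by
    rw [← integral_Ioc_eq_integral_Ioo, ← intervalIntegral.integral_of_le (exitRadius_mono hc hcr),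
      intervalIntegral.integral_const_mul, integral_id]
  rw [← hpow, ← integral_indicator measurableSet_Ioo, ← integral_indicator measurableSet_Ioi]
  refine integral_congr_ae (.of_forall fun s ↦ ?_)
  by_cases hs : 0 < s
  · simp only [indicator, mem_Ioi, hs, if_true, mem_ofPred_eq, mem_Ioo, add_sub_cancel_right,
      (norm_smul_add_cmp hθ hc hs).2, (norm_smul_add_cmp hθ (hc.trans_le hcr) hs).1, mul_ite,
      mul_zero, hhom s hs, mul_comm s]
  · have : ¬ exitRadius w c θ.1 < s := fun h ↦ hs ((exitRadius_pos hc).trans h)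
    simp [indicator, hs, this]

/-- Newton's theorem for a homogeneous kernel: the sphere, with the kernel `k`, exerts a constant
potential on its interior. -/
theorem integral_sphere_shift {k : E → ℝ} (hk : ContinuousOn k {0}ᶜ) (heven : ∀ v, k (-v) = k v)
    (hhom : ∀ s > 0, ∀ v, s ^ (Module.finrank ℝ E - 1) * k (s • v) = s * k v)
    {w : E} (hw : ‖w‖ < 1) :
    ∫ θ : sphere (0 : E) 1, k (θ.1 - w) ∂μ.toSphere =
      ∫ θ : sphere (0 : E) 1, k θ.1 ∂μ.toSphere := by
  obtain ⟨c, hwc, hc1⟩ := exists_between hw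
  set K := ∫ θ : sphere (0 : E) 1, k θ.1 ∂μ.toSphere
  have hd := hasDerivAt_integral_shell μ hc1 one_lt_two (continuousOn_shift hk 2 hwc)
  have hd2 : HasDerivAt (fun r : ℝ ↦ (r ^ 2 - c ^ 2) / 2 * K) K 1 := by
    have := (((hasDerivAt_pow 2 (1 : ℝ)).sub_const (c ^ 2)).div_const 2).mul_const K
    simpa using this
  refine hd.unique (hd2.congr_of_eventuallyEq ?_)
  filter_upwards [Ioi_mem_nhds hc1] with r hr
  have hkc : Continuous fun θ : sphere (0 : E) 1 ↦ k θ.1 :=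
    hk.comp_continuous continuous_subtype_val fun θ ↦ ne_zero_of_mem_unit_sphere θ
  have hcE : ∀ (w : E) (t : ℝ), Continuous fun θ : sphere (0 : E) 1 ↦ exitRadius w t θ.1 := by
    intro w t
    unfold exitRadius
    fun_prop
  have hI : ∀ w : E, Integrable (fun θ : sphere (0 : E) 1 ↦
      k θ.1 * ((exitRadius w r θ.1 ^ 2 - exitRadius w c θ.1 ^ 2) / 2)) μ.toSphere := by
    intro w
    have h1 := hcE w r
    have h2 := hcE w c
    refine Continuous.integrable_of_hasCompactSupport
      (hkc.mul (((h1.pow 2).sub (h2.pow 2)).div_const 2))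
      (HasCompactSupport.of_compactSpace _)
  have hsymm : ∫ u in {u : E | c < ‖u‖ ∧ ‖u‖ < r}, k (u - w) ∂μ =
      ∫ u in {u : E | c < ‖u‖ ∧ ‖u‖ < r}, k (u - -w) ∂μ := by
    rw [← integral_indicator (measurableSet_shell c r), ← integral_neg_eq_self,
      ← integral_indicator (measurableSet_shell c r)]
    refine integral_congr_ae (.of_forall fun u ↦ ?_)
    simp only [indicator, mem_ofPred_eq, norm_neg, sub_neg_eq_add]
    rw [← heven (-u - w), neg_sub, sub_neg_eq_add, add_comm]
  have h1 := integral_shell_shift μ hk hhom hwc (mem_Ioi.1 hr).le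
  have h2 := integral_shell_shift μ hk hhom (w := -w) (by simpa using hwc) (mem_Ioi.1 hr).le
  have h3 := integral_add (hI w) (hI (-w))
  have h4 : ∫ θ : sphere (0 : E) 1,
      (k θ.1 * ((exitRadius w r θ.1 ^ 2 - exitRadius w c θ.1 ^ 2) / 2) +
      k θ.1 * ((exitRadius (-w) r θ.1 ^ 2 - exitRadius (-w) c θ.1 ^ 2) / 2)) ∂μ.toSphere =
      (r ^ 2 - c ^ 2) * K := by
    rw [← integral_const_mul]
    refine integral_congr_ae (.of_forall fun θ ↦ ?_)
    have e1 := exitRadius_sq_add (θ := θ.1) hwc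
    have e2 := exitRadius_sq_add (θ := θ.1) (hwc.trans hr)
    simp only
    linear_combination k θ.1 / 2 * (e2 - e1)
  linarith

end Newton

theorem differentiableAt_integral_sub {H α : Type*} [NormedAddCommGroup H] [NormedSpace ℝ H]
    [ProperSpace H] [TopologicalSpace α] [T2Space α] [MeasurableSpace α] [OpensMeasurableSpace α]
    [SecondCountableTopology α]
    (μ : Measure α) [IsFiniteMeasureOnCompacts μ] {Φ : H → ℝ} {U : Set H} (hU : IsOpen U)
    (hΦ : ContDiffOn ℝ 1 Φ U) {T : α → H} (hT : Continuous T) {s K : Set α} (hK : IsCompact K)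
    (hs : MeasurableSet s) (hsK : s ⊆ K) {x : H} (hx : ∀ u ∈ K, x - T u ∈ U) :
    DifferentiableAt ℝ (fun x ↦ ∫ u in s, Φ (x - T u) ∂μ) x := by
  have hL : IsCompact ((fun u ↦ x - T u) '' K) := hK.image (by fun_prop)
  obtain ⟨ε, hε, hεU⟩ := hL.exists_cthickening_subset_open hU
    (by rintro _ ⟨u, hu, rfl⟩; exact hx u hu)
  have hmem : ∀ y ∈ ball x ε, ∀ u ∈ K, y - T u ∈ cthickening ε ((fun u ↦ x - T u) '' K) := by
    intro y hy u hu
    refine mem_cthickening_of_dist_le _ (x - T u) _ _ ⟨u, hu, rfl⟩ ?_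
    rw [dist_sub_right]
    exact (mem_ball.1 hy).le
  have hfd : ContinuousOn (fderiv ℝ Φ) U := hΦ.continuousOn_fderiv_of_isOpen hU le_rfl
  obtain ⟨M, hM⟩ := (hL.cthickening (r := ε)).exists_bound_of_continuousOn (hfd.mono hεU)
  have hxb : x ∈ ball x ε := mem_ball_self hε
  have hcont : ∀ y ∈ ball x ε, ContinuousOn (fun u ↦ Φ (y - T u)) K := fun y hy ↦
    hΦ.continuousOn.comp (by fun_prop) fun u hu ↦ hεU (hmem y hy u hu)
  have hfin : μ s ≠ ⊤ := ne_top_of_le_ne_top hK.measure_ne_top (measure_mono hsK)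
  refine (hasFDerivAt_integral_of_dominated_of_fderiv_le (μ := μ.restrict s)
    (F := fun y u ↦ Φ (y - T u)) (F' := fun y u ↦ fderiv ℝ Φ (y - T u)) (bound := fun _ ↦ M)
    (ball_mem_nhds x hε) ?_ ?_ ?_ ?_ ?_ ?_).differentiableAt
  · filter_upwards [ball_mem_nhds x hε] with y hy
    exact ((hcont y hy).mono hsK).aestronglyMeasurable hs
  · exact ((hcont x hxb).integrableOn_compact hK).mono_set hsK
  · exact ((hfd.comp (by fun_prop) fun u hu ↦ hεU (hmem x hxb u hu)).mono
      hsK).aestronglyMeasurable hs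
  · exact (ae_restrict_iff' hs).2 (.of_forall fun u hu y hy ↦ hM _ (hmem y hy u (hsK hu)))
  · exact integrableOn_const hfin
  · refine (ae_restrict_iff' hs).2 (.of_forall fun u hu y hy ↦ ?_)
    have hd : DifferentiableAt ℝ Φ (y - T u) :=
      (hΦ.differentiableOn one_ne_zero).differentiableAt
        (hU.mem_nhds (hεU (hmem y hy u (hsK hu))))
    simpa using! hd.hasFDerivAt.comp y ((hasFDerivAt_id y).sub_const (T u))

section Diagonal
variable {ι : Type*} [Fintype ι]

/-- The power `p` of the Euclidean length of a vector in coordinates. -/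
noncomputable def lengthPow (p : ℤ) (v : ι → ℝ) : ℝ := √(∑ i, v i ^ 2) ^ p

theorem sum_sq_pos {v : ι → ℝ} (hv : v ≠ 0) : 0 < ∑ i, v i ^ 2 := by
  obtain ⟨i, hi⟩ := Function.ne_iff.1 hv
  exact Finset.sum_pos' (fun _ _ ↦ sq_nonneg _) ⟨i, Finset.mem_univ _, by
    have : v i ≠ 0 := hi
    positivity⟩

theorem contDiffOn_lengthPow (p : ℤ) : ContDiffOn ℝ 1 (lengthPow (ι := ι) p) {0}ᶜ := by
  intro v hv
  have hpos := sum_sq_pos hv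
  refine ContDiffAt.contDiffWithinAt ?_
  have h1 : ContDiffAt ℝ 1 (fun v : ι → ℝ ↦ √(∑ i, v i ^ 2)) v :=
    ContDiffAt.sqrt (by fun_prop) hpos.ne'
  have hne : √(∑ i, v i ^ 2) ≠ 0 := (Real.sqrt_pos.2 hpos).ne'
  unfold lengthPow
  cases p with
  | ofNat n => simpa using h1.pow n
  | negSucc n => simpa using! (h1.pow (n + 1)).inv (pow_ne_zero _ hne)

theorem lengthPow_neg (p : ℤ) (v : ι → ℝ) : lengthPow p (-v) = lengthPow p v := by
  simp [lengthPow]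

theorem lengthPow_smul (p : ℤ) {s : ℝ} (hs : 0 < s) (v : ι → ℝ) :
    lengthPow p (s • v) = s ^ p * lengthPow p v := by
  simp only [lengthPow, Pi.smul_apply, smul_eq_mul, mul_pow, ← Finset.mul_sum]
  rw [Real.sqrt_mul (sq_nonneg s), Real.sqrt_sq hs.le, mul_zpow]

/-- Ivory's identity: for unit vectors `ω`, `σ`, the point of the ellipsoid with semiaxes `A`
over `ω` and the point of the confocal ellipsoid with semiaxes `D` over `σ` are as far from each
other as the two points with the roles exchanged. -/
theorem lengthPow_ivory (p : ℤ) {A D ω σ : ι → ℝ} {t : ℝ} (hA : ∀ i, A i ^ 2 = D i ^ 2 + t)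
    (hω : ∑ i, ω i ^ 2 = 1) (hσ : ∑ i, σ i ^ 2 = 1) :
    lengthPow p (A * ω - D * σ) = lengthPow p (A * σ - D * ω) := by
  have : ∑ i, (A i * ω i - D i * σ i) ^ 2 - ∑ i, (A i * σ i - D i * ω i) ^ 2 =
      t * (∑ i, ω i ^ 2 - ∑ i, σ i ^ 2) := by
    rw [← Finset.sum_sub_distrib, ← Finset.sum_sub_distrib, Finset.mul_sum]
    refine Finset.sum_congr rfl fun i _ ↦ ?_
    linear_combination (ω i ^ 2 - σ i ^ 2) * hA i
  have heq : ∑ i, (A i * ω i - D i * σ i) ^ 2 = ∑ i, (A i * σ i - D i * ω i) ^ 2 := by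
    rw [hω, hσ] at this
    linarith
  simp [lengthPow, heq]

theorem sum_sq_eq_one_of_mem_sphere (θ : sphere (0 : EuclideanSpace ℝ ι) 1) :
    ∑ i, θ.1 i ^ 2 = 1 := by
  have := EuclideanSpace.real_norm_sq_eq θ.1
  rw [norm_eq_of_mem_sphere θ] at this
  linarith

/-- Ivory's theorem for the equilibrium distribution, written on the sphere. -/
theorem integral_sphere_lengthPow_confocal [Nonempty ι] {A D x : ι → ℝ} {t : ℝ} (ht : 0 < t)
    (hApos : ∀ i, 0 < A i) (hA : ∀ i, A i ^ 2 = D i ^ 2 + t) (hx : ∑ i, x i ^ 2 / A i ^ 2 = 1) :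
    ∫ θ : sphere (0 : EuclideanSpace ℝ ι) 1, lengthPow (2 - (Fintype.card ι : ℤ))
        (x - D * θ.1.ofLp) ∂(volume : Measure (EuclideanSpace ℝ ι)).toSphere =
      ∫ θ : sphere (0 : EuclideanSpace ℝ ι) 1, lengthPow (2 - (Fintype.card ι : ℤ))
        (A * θ.1.ofLp) ∂(volume : Measure (EuclideanSpace ℝ ι)).toSphere := by
  set p : ℤ := 2 - (Fintype.card ι : ℤ) with hp
  set ω : ι → ℝ := x / A
  have hxω : x = A * ω := by
    ext i
    simp [ω, mul_div_cancel₀ _ (hApos i).ne']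
  have hω : ∑ i, ω i ^ 2 = 1 := by simpa [ω, div_pow] using hx
  set w : EuclideanSpace ℝ ι := WithLp.toLp 2 (D * ω / A) with hwdef
  have hw : ‖w‖ < 1 := by
    refine (sq_lt_one_iff₀ (norm_nonneg _)).1 ?_
    rw [EuclideanSpace.real_norm_sq_eq, ← hω]
    have hle : ∀ i, w i ^ 2 + t / A i ^ 2 * ω i ^ 2 = ω i ^ 2 := by
      intro i
      have := (hApos i).ne'
      simp only [w, Pi.div_apply, Pi.mul_apply]
      field_simp
      rw [hA i]
    obtain ⟨i, hi⟩ : ∃ i, ω i ≠ 0 := by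
      by_contra! h
      simp [h] at hω
    refine Finset.sum_lt_sum (fun j _ ↦ ?_) ⟨i, Finset.mem_univ _, ?_⟩
    · have := hle j
      have : 0 ≤ t / A j ^ 2 * ω j ^ 2 := by positivity
      linarith
    · have := hle i
      have h1 := hApos i
      have : 0 < t / A i ^ 2 * ω i ^ 2 := by positivity
      linarith
  have hnewton := integral_sphere_shift (volume : Measure (EuclideanSpace ℝ ι))
    (k := fun v ↦ lengthPow p (A * v.ofLp)) ?_ ?_ ?_ hw
  · rw [← hnewton]
    refine integral_congr_ae (.of_forall fun θ ↦ ?_)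
    have hAw : A * (θ.1 - w).ofLp = A * θ.1.ofLp - D * ω := by
      ext i
      simp only [WithLp.ofLp_sub, hwdef, Pi.mul_apply, Pi.sub_apply, Pi.div_apply]
      have := (hApos i).ne'
      field_simp
    simp only [hAw]
    rw [hxω]
    exact lengthPow_ivory p hA hω (sum_sq_eq_one_of_mem_sphere θ)
  · refine (contDiffOn_lengthPow p).continuousOn.comp (by fun_prop) fun v hv ↦ ?_
    contrapose! hv
    simp only [mem_compl_iff, mem_singleton_iff, not_not] at hv ⊢
    ext i
    simpa [(hApos i).ne'] using congrFun hv i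
  · intro v
    simp only [WithLp.ofLp_neg, mul_neg, lengthPow_neg]
  · intro s hs v
    have : A * (s • v).ofLp = s • (A * v.ofLp) := by
      ext i
      simp only [WithLp.ofLp_smul, Pi.mul_apply, Pi.smul_apply, smul_eq_mul]
      ring
    simp only [this]
    rw [lengthPow_smul p hs, ← mul_assoc, finrank_euclideanSpace, ← zpow_natCast,
      ← zpow_add₀ hs.ne', Nat.cast_sub Fintype.card_pos, hp]
    ring_nf
    simp [mul_comm]

/-- Up to a factor, the potential of the mother body with semiaxes `D`, obtained by projecting
the unit ball. -/
noncomputable def ballPotential (D x : ι → ℝ) : ℝ :=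
  ∫ u in ball (0 : EuclideanSpace ℝ ι) 1, lengthPow (2 - (Fintype.card ι : ℤ)) (x - D * u.ofLp)

theorem continuousOn_lengthPow_sub (p : ℤ) {D x : ι → ℝ} {s : Set (EuclideanSpace ℝ ι)}
    (hx : ∀ u ∈ s, D * u.ofLp ≠ x) :
    ContinuousOn (fun u : EuclideanSpace ℝ ι ↦ lengthPow p (x - D * u.ofLp)) s :=
  (contDiffOn_lengthPow p).continuousOn.comp (by fun_prop) fun u hu ↦
    sub_ne_zero.2 (hx u hu).symm

theorem differentiableAt_ballPotential {D x : ι → ℝ}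
    (hx : ∀ u : EuclideanSpace ℝ ι, ‖u‖ ≤ 1 → D * u.ofLp ≠ x) :
    DifferentiableAt ℝ (ballPotential D) x :=
  differentiableAt_integral_sub volume isOpen_compl_singleton
    (contDiffOn_lengthPow (2 - (Fintype.card ι : ℤ)))
    (T := fun u : EuclideanSpace ℝ ι ↦ D * u.ofLp) (by fun_prop)
    (isCompact_closedBall (0 : EuclideanSpace ℝ ι) 1) measurableSet_ball ball_subset_closedBall
    fun u hu ↦ sub_ne_zero.2 (hx u (by simpa using hu)).symm

theorem ballPotential_inv_smul [Nonempty ι] (D x : ι → ℝ) {r : ℝ} (hr : 0 < r) :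
    r ^ 2 * ballPotential D (r⁻¹ • x) = ∫ u in ball (0 : EuclideanSpace ℝ ι) r,
      lengthPow (2 - (Fintype.card ι : ℤ)) (x - D * u.ofLp) := by
  have h1 := Measure.setIntegral_comp_smul_of_pos (volume : Measure (EuclideanSpace ℝ ι))
    (fun u ↦ lengthPow (2 - (Fintype.card ι : ℤ)) (x - D * u.ofLp)) (ball 0 1) hr
  rw [_root_.smul_ball hr.ne', smul_zero, mul_one, Real.norm_of_nonneg hr.le,
    finrank_euclideanSpace] at h1
  have h2 : ballPotential D (r⁻¹ • x) = (r⁻¹) ^ (2 - (Fintype.card ι : ℤ)) *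
      ∫ u in ball (0 : EuclideanSpace ℝ ι) 1,
        lengthPow (2 - (Fintype.card ι : ℤ)) (x - D * (r • u).ofLp) := by
    rw [ballPotential, ← integral_const_mul]
    refine integral_congr_ae (.of_forall fun u ↦ ?_)
    simp only
    rw [← lengthPow_smul _ (inv_pos.2 hr)]
    congr 1
    ext i
    simp
    field_simp
  rw [h2, h1, smul_eq_mul, ← mul_assoc, ← mul_assoc]
  have : r ^ 2 * r⁻¹ ^ (2 - (Fintype.card ι : ℤ)) * (r ^ Fintype.card ι)⁻¹ = 1 := by
    rw [inv_zpow', neg_sub, zpow_sub₀ hr.ne']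
    have := hr.ne'
    simp
    field_simp
  rw [this, one_mul]

theorem two_mul_ballPotential_sub_fderiv [Nonempty ι] {D x : ι → ℝ}
    (hx : ∀ u : EuclideanSpace ℝ ι, ‖u‖ ≤ 1 → D * u.ofLp ≠ x) :
    2 * ballPotential D x - fderiv ℝ (ballPotential D) x x =
      ∫ θ : sphere (0 : EuclideanSpace ℝ ι) 1, lengthPow (2 - (Fintype.card ι : ℤ))
        (x - D * θ.1.ofLp) ∂(volume : Measure (EuclideanSpace ℝ ι)).toSphere := by
  have hopen : IsOpen {u : EuclideanSpace ℝ ι | D * u.ofLp ≠ x} :=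
    isOpen_ne_fun (by fun_prop) continuous_const
  obtain ⟨δ, hδ, hδU⟩ := (isCompact_closedBall (0 : EuclideanSpace ℝ ι) 1
    ).exists_cthickening_subset_open hopen fun u hu ↦ hx u (by simpa using hu)
  rw [cthickening_closedBall hδ.le zero_le_one] at hδU
  have hshell := hasDerivAt_integral_shell (volume : Measure (EuclideanSpace ℝ ι))
    (c := -1) (q := δ + 1) (by norm_num) (by linarith)
    (continuousOn_lengthPow_sub (2 - (Fintype.card ι : ℤ)) (D := D) (x := x)
      fun u hu ↦ hδU (by simpa using hu.2))
  have hscale : HasDerivAt (fun r : ℝ ↦ r ^ 2 * ballPotential D (r⁻¹ • x))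
      (2 * ballPotential D x - fderiv ℝ (ballPotential D) x x) 1 := by
    have hinv : HasDerivAt (fun r : ℝ ↦ r⁻¹ • x) (-x) 1 := by
      simpa using (hasDerivAt_inv (one_ne_zero (α := ℝ))).smul_const x
    have hd : HasFDerivAt (ballPotential D) (fderiv ℝ (ballPotential D) x) ((1 : ℝ)⁻¹ • x) := by
      simpa using (differentiableAt_ballPotential hx).hasFDerivAt
    have := (hasDerivAt_pow 2 (1 : ℝ)).mul (hd.comp_hasDerivAt 1 hinv)
    simpa [sub_eq_add_neg] using! this
  refine hscale.unique (hshell.congr_of_eventuallyEq ?_)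
  filter_upwards [Ioi_mem_nhds one_pos] with r hr
  rw [ballPotential_inv_smul D x hr]
  congr 2
  ext u
  simp [(neg_one_lt_zero (R := ℝ)).trans_le (norm_nonneg u)]

end Diagonal

section Slicing

theorem integral_pi_diagonal {ι : Type*} [Fintype ι] {b : ι → ℝ} (hb : ∀ i, 0 < b i)
    (g : (ι → ℝ) → ℝ) : ∫ y, g y = (∏ i, b i) * ∫ z, g (b * z) := by
  classical
  have hprod : 0 < ∏ i, b i := Finset.prod_pos fun i _ ↦ hb i
  have hdet : (Matrix.diagonal b).det = ∏ i, b i := Matrix.det_diagonal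
  have hfun : ⇑(Matrix.toLin' (Matrix.diagonal b)) = fun z ↦ b * z := by
    ext z i
    simp [Matrix.mulVec_diagonal]
  have hemb : MeasurableEmbedding fun z : ι → ℝ ↦ b * z := by
    refine Continuous.measurableEmbedding (by fun_prop) fun z z' h ↦ ?_
    ext i
    simpa [(hb i).ne'] using congrFun h i
  have h := Real.smul_map_diagonal_volume_pi (D := b) (by rw [hdet]; exact hprod.ne')
  rw [hdet, hfun, abs_of_pos hprod] at h
  conv_lhs => rw [← h]
  rw [integral_smul_measure, hemb.integral_map, ENNReal.toReal_ofReal hprod.le, smul_eq_mul]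

theorem volume_real_sq_lt (A : ℝ) : volume.real {t : ℝ | t ^ 2 < A} = 2 * √A := by
  have : {t : ℝ | t ^ 2 < A} = Ioo (-√A) (√A) := by
    ext t
    exact Real.sq_lt
  rw [this, Real.volume_real_Ioo_of_le (by linarith [Real.sqrt_nonneg A])]
  ring

/-- Projecting the unit ball of `ℝⁿ⁺¹` to `ℝⁿ`. -/
theorem integral_ball_succ {n : ℕ} {F : (Fin n → ℝ) → ℝ}
    (hF : IntegrableOn (fun u : EuclideanSpace ℝ (Fin (n + 1)) ↦ F fun i ↦ u i.castSucc)
      (ball 0 1)) :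
    ∫ u in ball (0 : EuclideanSpace ℝ (Fin (n + 1))) 1, F (fun i ↦ u i.castSucc) =
      ∫ z in {z : Fin n → ℝ | ∑ i, z i ^ 2 ≤ 1}, 2 * √(1 - ∑ i, z i ^ 2) * F z := by
  set S : Set (ℝ × (Fin n → ℝ)) := {p | p.1 ^ 2 < 1 - ∑ i, p.2 i ^ 2} with hS
  have hSm : MeasurableSet S := measurableSet_lt (by fun_prop) (by fun_prop)
  set e : EuclideanSpace ℝ (Fin (n + 1)) ≃ᵐ ℝ × (Fin n → ℝ) :=
    (MeasurableEquiv.toLp 2 (Fin (n + 1) → ℝ)).symm.trans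
      (MeasurableEquiv.piFinSuccAbove (fun _ ↦ ℝ) (Fin.last n)) with he
  have hmp : MeasurePreserving e :=
    (EuclideanSpace.volume_preserving_symm_measurableEquiv_toLp (Fin (n + 1))).trans
      (volume_preserving_piFinSuccAbove (fun _ ↦ ℝ) (Fin.last n))
  have he1 : ∀ u, (e u).1 = u (Fin.last n) := fun u ↦ rfl
  have he2 : ∀ u, (e u).2 = fun i ↦ u i.castSucc := by
    intro u
    ext i
    simp [he, MeasurableEquiv.piFinSuccAbove, Fin.init]
  have hball : e ⁻¹' S = ball 0 1 := by
    ext u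
    rw [mem_preimage, hS, mem_ofPred_eq, he1, he2, mem_ball_zero_iff,
      ← sq_lt_one_iff₀ (norm_nonneg u), EuclideanSpace.real_norm_sq_eq, Fin.sum_univ_castSucc]
    constructor <;> intro h <;> linarith
  have hF' : IntegrableOn (fun p : ℝ × (Fin n → ℝ) ↦ F p.2) S := by
    rw [← hmp.integrableOn_comp_preimage e.measurableEmbedding, hball]
    refine hF.congr (.of_forall fun u ↦ ?_)
    simp only [Function.comp, he2]
  calc _ = ∫ u in e ⁻¹' S, F (e u).2 := by simp only [hball, he2]
    _ = ∫ p in S, F p.2 := hmp.setIntegral_preimage_emb e.measurableEmbedding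
        (fun p ↦ F p.2) S
    _ = ∫ p, S.indicator (fun p ↦ F p.2) p := (integral_indicator hSm).symm
    _ = ∫ z, ∫ t, S.indicator (fun p ↦ F p.2) (t, z) :=
        integral_prod_symm _ (hF'.integrable_indicator hSm)
    _ = ∫ z, 2 * √(1 - ∑ i, z i ^ 2) * F z := by
        refine integral_congr_ae (.of_forall fun z ↦ ?_)
        simp only
        rw [← volume_real_sq_lt, ← smul_eq_mul, ← setIntegral_const, ← integral_indicator
          (measurableSet_lt (by fun_prop) (by fun_prop))]
        rfl
    _ = _ := by
        refine (setIntegral_eq_integral_of_forall_compl_eq_zero fun z hz ↦ ?_).symm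
        rw [mem_ofPred_eq, not_le] at hz
        rw [Real.sqrt_eq_zero_of_nonpos (by linarith)]
        simp

/-- The potential of the mother body is, up to a factor, the projected ball potential. -/
theorem integral_motherBody {n : ℕ} {b : Fin n → ℝ} (hb : ∀ i, 0 < b i) (c : ℝ)
    {x : Fin (n + 1) → ℝ}
    (hx : ∀ u : EuclideanSpace ℝ (Fin (n + 1)), ‖u‖ ≤ 1 →
      (Fin.snoc b 0 : Fin (n + 1) → ℝ) * u.ofLp ≠ x) :
    ∫ y in {y : Fin n → ℝ | ∑ i, y i ^ 2 / b i ^ 2 ≤ 1},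
        c * √(1 - ∑ i, y i ^ 2 / b i ^ 2) *
          lengthPow (2 - (Fintype.card (Fin (n + 1)) : ℤ))
            (x - (Fin.snoc y 0 : Fin (n + 1) → ℝ)) =
      c * (∏ i, b i) / 2 * ballPotential (Fin.snoc b 0) x := by
  set p : ℤ := 2 - (Fintype.card (Fin (n + 1)) : ℤ)
  have hsnoc : ∀ u : EuclideanSpace ℝ (Fin (n + 1)),
      (Fin.snoc (b * fun i ↦ u i.castSucc) 0 : Fin (n + 1) → ℝ) = Fin.snoc b 0 * u.ofLp := by
    intro u
    ext i
    refine Fin.lastCases ?_ (fun j ↦ ?_) i <;> simp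
  have hint : IntegrableOn (fun u : EuclideanSpace ℝ (Fin (n + 1)) ↦
      lengthPow p (x - (Fin.snoc (b * fun i ↦ u i.castSucc) 0 : Fin (n + 1) → ℝ))) (ball 0 1) := by
    simp only [hsnoc]
    exact ((continuousOn_lengthPow_sub p fun u hu ↦ hx u (by simpa using hu)).integrableOn_compact
      (isCompact_closedBall 0 1)).mono_set ball_subset_closedBall
  have hball := integral_ball_succ (F := fun z ↦ lengthPow p
    (x - (Fin.snoc (b * z) 0 : Fin (n + 1) → ℝ))) hint
  simp only [hsnoc] at hball
  have hdiv : ∀ (z : Fin n → ℝ) i, (b * z) i ^ 2 / b i ^ 2 = z i ^ 2 := fun z i ↦ by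
    have := (hb i).ne'
    simp only [Pi.mul_apply]
    field_simp
  have hm1 : MeasurableSet {y : Fin n → ℝ | ∑ i, y i ^ 2 / b i ^ 2 ≤ 1} :=
    measurableSet_le (by fun_prop) (by fun_prop)
  have hm2 : MeasurableSet {z : Fin n → ℝ | ∑ i, z i ^ 2 ≤ 1} :=
    measurableSet_le (by fun_prop) (by fun_prop)
  rw [ballPotential, hball, ← integral_indicator hm1, integral_pi_diagonal hb,
    ← integral_indicator hm2, show ∀ I, c * (∏ i, b i) / 2 * I = (∏ i, b i) * (c / 2 * I) from
      fun I ↦ by ring, ← integral_const_mul (c / 2)]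
  refine congrArg (fun I : ℝ ↦ (∏ i, b i) * I) (integral_congr_ae (.of_forall fun z ↦ ?_))
  simp only [indicator, mem_ofPred_eq, hdiv]
  split_ifs
  · ring
  · simp

theorem ne_of_mem_confocal {ι : Type*} [Fintype ι] {A D x : ι → ℝ} {t : ℝ} (ht : 0 < t)
    (hApos : ∀ i, 0 < A i) (hA : ∀ i, A i ^ 2 = D i ^ 2 + t) (hx : ∑ i, x i ^ 2 / A i ^ 2 = 1)
    (u : EuclideanSpace ℝ ι) (hu : ‖u‖ ≤ 1) : D * u.ofLp ≠ x := by
  rintro rfl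
  have hle : ∀ i, (D * u.ofLp) i ^ 2 / A i ^ 2 + t / A i ^ 2 * u i ^ 2 = u i ^ 2 := by
    intro i
    have := (hApos i).ne'
    simp only [Pi.mul_apply]
    field_simp
    rw [hA i]
  have hu2 : ∑ i, u i ^ 2 ≤ 1 := by
    rw [← EuclideanSpace.real_norm_sq_eq]
    exact pow_le_one₀ (norm_nonneg u) hu
  obtain ⟨i, hi⟩ : ∃ i, u i ≠ 0 := by
    by_contra! h
    simp [h] at hx
  have hlt : ∑ i, (D * u.ofLp) i ^ 2 / A i ^ 2 < ∑ i, u i ^ 2 := by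
    refine Finset.sum_lt_sum (fun j _ ↦ ?_) ⟨i, Finset.mem_univ _, ?_⟩
    · have : 0 ≤ t / A j ^ 2 * u j ^ 2 := by positivity
      linarith [hle j]
    · have h1 := hApos i
      have : 0 < t / A i ^ 2 * u i ^ 2 := by positivity
      linarith [hle i]
  linarith

theorem eventually_ne_image_closedBall {ι : Type*} [Fintype ι] {D x : ι → ℝ}
    (hx : ∀ u : EuclideanSpace ℝ ι, ‖u‖ ≤ 1 → D * u.ofLp ≠ x) :
    ∀ᶠ z in nhds x, ∀ u : EuclideanSpace ℝ ι, ‖u‖ ≤ 1 → D * u.ofLp ≠ z := by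
  have hK : IsCompact ((fun u : EuclideanSpace ℝ ι ↦ D * u.ofLp) '' closedBall 0 1) :=
    (isCompact_closedBall 0 1).image (by fun_prop)
  have hxK : x ∉ (fun u : EuclideanSpace ℝ ι ↦ D * u.ofLp) '' closedBall 0 1 := by
    rintro ⟨u, hu, rfl⟩
    exact hx u (by simpa using hu) rfl
  filter_upwards [hK.isClosed.isOpen_compl.mem_nhds hxK] with z hz u hu h
  exact hz ⟨u, by simpa using hu, h⟩

end Slicing

/-- **Ivory's theorem** (Corollary 3.3): the equilibrium potential
`V(x) = (1/B)(μ̂(x) − ½ Σ xᵢ ∂μ̂/∂xᵢ(x))` of the ellipsoid `Ω = {x : Σ xⱼ²/aⱼ² ≤ 1}`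
(`a₁ > ⋯ > a_N > 0`, `N ≥ 3`), where `B = C_N ∫_Ω |y|^{2−N}dy` and
`μ̂(x) = C_N ∫_E |x−y|^{2−N} dμ(y)` is the potential of the mother body measure `μ` of the
focal ellipsoid `E`, is constant on each confocal ellipsoid
`Γ_λ = {x : Σ xⱼ²/(aⱼ²+λ) = 1}`, `λ > 0`: the equipotential surfaces of `V` are the
ellipsoids confocal with `∂Ω`. -/
theorem ivory_equipotentials_are_confocal
    (N : ℕ) (hN : 3 ≤ N) (a : Fin N → ℝ) (hpos : ∀ j, 0 < a j)
    (hstrict : ∀ i j : Fin N, i < j → a j < a i) :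
    let lN : Fin N := ⟨N - 1, by omega⟩
    let cast : Fin (N - 1) → Fin N := Fin.castLE (by omega)
    let emb : (Fin (N - 1) → ℝ) → (Fin N → ℝ) :=
      fun y' i => if h : (i : ℕ) < N - 1 then y' ⟨i, h⟩ else 0
    let ρ : (Fin (N - 1) → ℝ) → ℝ := fun y' =>
      2 * (∏ j, a j) *
        (∏ j : Fin (N - 1), ((a (cast j)) ^ 2 - (a lN) ^ 2)) ^ (-(1 / 2) : ℝ) *
        Real.sqrt (1 - ∑ j, (y' j) ^ 2 / ((a (cast j)) ^ 2 - (a lN) ^ 2))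
    let E' : Set (Fin (N - 1) → ℝ) :=
      {y' | ∑ j, (y' j) ^ 2 / ((a (cast j)) ^ 2 - (a lN) ^ 2) ≤ 1}
    let Ω : Set (Fin N → ℝ) := {x | ∑ j, (x j) ^ 2 / (a j) ^ 2 ≤ 1}
    let C : ℝ := 1 / ((N : ℝ) * (volume {x : Fin N → ℝ | ∑ j, (x j) ^ 2 ≤ 1}).toReal)
    let B : ℝ := C * ∫ y in Ω, Real.sqrt (∑ j, (y j) ^ 2) ^ (2 - (N : ℤ))
    let muHat : (Fin N → ℝ) → ℝ := fun x =>
      C * ∫ y' in E', ρ y' * Real.sqrt (∑ i, (x i - emb y' i) ^ 2) ^ (2 - (N : ℤ))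
    let V : (Fin N → ℝ) → ℝ := fun x =>
      (1 / B) * (muHat x - (1 / 2) * ∑ i, x i * fderiv ℝ muHat x (Pi.single i 1))
    ∀ lam : ℝ, 0 < lam → ∀ x y : Fin N → ℝ,
      (∑ j, (x j) ^ 2 / ((a j) ^ 2 + lam)) = 1 →
      (∑ j, (y j) ^ 2 / ((a j) ^ 2 + lam)) = 1 →
      V x = V y := by
  obtain ⟨n, rfl⟩ : ∃ n, N = n + 1 := ⟨N - 1, by omega⟩
  intro lN cast emb ρ E' Ω C B muHat V lam hlam x y hx hy
  have hdiff : ∀ i : Fin n, 0 < a i.castSucc ^ 2 - a (Fin.last n) ^ 2 := fun i ↦ by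
    have h1 := hstrict _ _ (Fin.castSucc_lt_last i)
    have h2 := hpos (Fin.last n)
    nlinarith
  set b : Fin n → ℝ := fun i ↦ √(a i.castSucc ^ 2 - a (Fin.last n) ^ 2)
  have hbpos : ∀ i, 0 < b i := fun i ↦ Real.sqrt_pos.2 (hdiff i)
  have hbsq : ∀ i, b i ^ 2 = a i.castSucc ^ 2 - a (Fin.last n) ^ 2 := fun i ↦
    Real.sq_sqrt (hdiff i).le
  set D : Fin (n + 1) → ℝ := Fin.snoc b 0
  set A : Fin (n + 1) → ℝ := fun i ↦ √(a i ^ 2 + lam)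
  set t : ℝ := a (Fin.last n) ^ 2 + lam
  have htpos : 0 < t := by positivity
  have hApos : ∀ i, 0 < A i := fun i ↦ Real.sqrt_pos.2 (by positivity)
  have hAsq : ∀ i, A i ^ 2 = a i ^ 2 + lam := fun i ↦ Real.sq_sqrt (by positivity)
  have hAD : ∀ i, A i ^ 2 = D i ^ 2 + t := by
    intro i
    rw [hAsq]
    refine Fin.lastCases ?_ (fun j ↦ ?_) i
    · simp [D, t]
    · simp only [D, t, Fin.snoc_castSucc, hbsq]
      ring
  set c : ℝ := 2 * (∏ j, a j) *
    (∏ j : Fin n, (a j.castSucc ^ 2 - a (Fin.last n) ^ 2)) ^ (-(1 / 2) : ℝ)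
  have hmu : ∀ z : Fin (n + 1) → ℝ, (∀ u : EuclideanSpace ℝ (Fin (n + 1)), ‖u‖ ≤ 1 →
      D * u.ofLp ≠ z) → muHat z = C * (c * (∏ i, b i) / 2) * ballPotential D z := by
    intro z hz
    rw [mul_assoc, ← integral_motherBody hbpos c hz]
    simp only [hbsq, Fintype.card_fin]
    rfl
  suffices h : ∀ z : Fin (n + 1) → ℝ, ∑ j, z j ^ 2 / (a j ^ 2 + lam) = 1 →
      V z = 1 / B * (C * (c * (∏ i, b i) / 2) / 2) *
        ∫ θ : sphere (0 : EuclideanSpace ℝ (Fin (n + 1))) 1,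
          lengthPow (2 - (Fintype.card (Fin (n + 1)) : ℤ)) (A * θ.1.ofLp)
          ∂(volume : Measure (EuclideanSpace ℝ (Fin (n + 1)))).toSphere by
    rw [h x hx, h y hy]
  intro z hz
  simp only [← hAsq] at hz
  have hzD := ne_of_mem_confocal htpos hApos hAD hz
  have hev : muHat =ᶠ[nhds z] fun z ↦ C * (c * (∏ i, b i) / 2) * ballPotential D z := by
    filter_upwards [eventually_ne_image_closedBall hzD] with z hz using hmu z hz
  have hfd : fderiv ℝ muHat z z =
      C * (c * (∏ i, b i) / 2) * fderiv ℝ (ballPotential D) z z := by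
    rw [hev.fderiv_eq, fderiv_const_mul (differentiableAt_ballPotential hzD)]
    rfl
  have hsum : ∑ i, z i * fderiv ℝ muHat z (Pi.single i 1) = fderiv ℝ muHat z z := by
    generalize fderiv ℝ muHat z = L
    conv_rhs => rw [pi_eq_sum_univ' z]
    simp [map_sum]
  have hV : V z = 1 / B * (muHat z - 1 / 2 * fderiv ℝ muHat z z) := by
    rw [← hsum]
  rw [hV, hfd, hmu z hzD, ← integral_sphere_lengthPow_confocal htpos hApos hAD hz,
    ← two_mul_ballPotential_sub_fderiv hzD]
  ring
end

section
/- Let N ≥ 3 and a_1 > a_2 > ... > a_N > 0, let Ω = {x ∈ ℝ^N : Σ_{j=1}^N x_j²/a_j² ≤ 1}, let E = {y ∈ ℝ^N : y_N = 0, Σ_{j=1}^{N−1} y_j²/(a_j² − a_N²) ≤ 1} be the focal ellipsoid, and let u_Ω(x) = ∫_Ω |x − y|^{2−N} dy be the exterior Newtonian potential. Then there exists a function h harmonic on the open set ℝ^N \ E such that h(x) = u_Ω(x) for all x ∈ ℝ^N \ closure(Ω); that is, the exterior potential of the ellipsoid extends harmonically across ∂Ω into all of ℝ^N \ E. -/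
open MeasureTheory

/-- The Laplacian of `u : ℝᴺ → ℝ` at `x`, as the sum of second partial derivatives. -/
noncomputable def lap {N : ℕ} (u : (Fin N → ℝ) → ℝ) (x : Fin N → ℝ) : ℝ :=
  ∑ i, fderiv ℝ (fun y => fderiv ℝ u y (Pi.single i 1)) x (Pi.single i 1)

open Set Topology

section ParametricIntegral

variable {H Y V : Type*} [TopologicalSpace Y] [T2Space Y]
  [SecondCountableTopology Y] [MeasurableSpace Y] [BorelSpace Y]
  {μ : Measure Y} [IsFiniteMeasureOnCompacts μ]
  [NormedAddCommGroup V] [NormedSpace ℝ V]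

theorem continuousOn_setIntegral_of_isCompact [TopologicalSpace H] [FirstCountableTopology H]
    {K : Set H} {S : Set Y} (hK : IsCompact K) (hS : IsCompact S) {G : H → Y → V}
    (hG : ContinuousOn (Function.uncurry G) (K ×ˢ S)) :
    ContinuousOn (fun x => ∫ y in S, G x y ∂μ) K := by
  obtain ⟨C, hC⟩ := (hK.prod hS).exists_bound_of_continuousOn hG
  have hmeas : MeasurableSet S := hS.measurableSet
  intro x₀ hx₀
  refine continuousWithinAt_of_dominated (bound := fun _ => C) ?_ ?_ ?_ ?_
  · filter_upwards [self_mem_nhdsWithin] with x hx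
    exact (hG.uncurry_left x hx).aestronglyMeasurable hmeas
  · filter_upwards [self_mem_nhdsWithin] with x hx
    filter_upwards [ae_restrict_mem hmeas] with y hy
    exact hC (x, y) ⟨hx, hy⟩
  · exact integrableOn_const hS.measure_ne_top
  · filter_upwards [ae_restrict_mem hmeas] with y hy
    exact hG.uncurry_right y hy x₀ hx₀

theorem continuousOn_setIntegral_of_isOpen [TopologicalSpace H] [FirstCountableTopology H]
    [LocallyCompactSpace H] {U : Set H} {S : Set Y} (hU : IsOpen U) (hS : IsCompact S)
    {G : H → Y → V} (hG : ContinuousOn (Function.uncurry G) (U ×ˢ S)) :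
    ContinuousOn (fun x => ∫ y in S, G x y ∂μ) U := by
  intro x hx
  obtain ⟨K, hK, hxK, hKU⟩ := exists_compact_subset hU hx
  exact ((continuousOn_setIntegral_of_isCompact hK hS
    (hG.mono (prod_mono hKU subset_rfl))).continuousAt
      (mem_interior_iff_mem_nhds.1 hxK)).continuousWithinAt

theorem hasFDerivAt_setIntegral_of_continuousOn [NormedAddCommGroup H] [NormedSpace ℝ H]
    [LocallyCompactSpace H]
    {U : Set H} {S : Set Y} (hU : IsOpen U) (hS : IsCompact S)
    {G : H → Y → V} {G' : H → Y → H →L[ℝ] V}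
    (hG : ContinuousOn (Function.uncurry G) (U ×ˢ S))
    (hG' : ContinuousOn (Function.uncurry G') (U ×ˢ S))
    (hd : ∀ x ∈ U, ∀ y ∈ S, HasFDerivAt (fun x => G x y) (G' x y) x) {x₀ : H} (hx₀ : x₀ ∈ U) :
    HasFDerivAt (fun x => ∫ y in S, G x y ∂μ) (∫ y in S, G' x₀ y ∂μ) x₀ := by
  obtain ⟨K, hK, hxK, hKU⟩ := exists_compact_subset hU hx₀
  obtain ⟨C, hC⟩ := (hK.prod hS).exists_bound_of_continuousOn
    (hG'.mono (prod_mono hKU subset_rfl))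
  have hmeas : MeasurableSet S := hS.measurableSet
  refine hasFDerivAt_integral_of_dominated_of_fderiv_le (bound := fun _ => C)
    (mem_interior_iff_mem_nhds.1 hxK) ?_ ?_ ?_ ?_ ?_ ?_
  · filter_upwards [hU.mem_nhds hx₀] with x hx
    exact (hG.uncurry_left x hx).aestronglyMeasurable hmeas
  · exact (hG.uncurry_left x₀ hx₀).integrableOn_compact hS
  · exact (hG'.uncurry_left x₀ hx₀).aestronglyMeasurable hmeas
  · filter_upwards [ae_restrict_mem hmeas] with y hy x hx
    exact hC (x, y) ⟨hx, hy⟩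
  · exact integrableOn_const hS.measure_ne_top
  · filter_upwards [ae_restrict_mem hmeas] with y hy x hx
    exact hd x (hKU hx) y hy

end ParametricIntegral

section UnitBall

/-- The closed Euclidean unit ball of `Fin N → ℝ`. -/
def euclideanUnitBall (N : ℕ) : Set (Fin N → ℝ) := {y | ∑ j, y j ^ 2 ≤ 1}

theorem isCompact_euclideanUnitBall (N : ℕ) : IsCompact (euclideanUnitBall N) := by
  have hclosed : IsClosed (euclideanUnitBall N) :=
    isClosed_le (by fun_prop) continuous_const
  have hcube : IsCompact (univ.pi fun _ : Fin N => Icc (-1 : ℝ) 1) :=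
    isCompact_univ_pi fun _ => isCompact_Icc
  refine hcube.of_isClosed_subset hclosed fun y hy j _ => abs_le.1 ?_
  rw [← sq_le_one_iff_abs_le_one]
  exact (Finset.single_le_sum (f := fun j => y j ^ 2) (fun j _ => sq_nonneg _)
    (Finset.mem_univ j)).trans hy

theorem setIntegral_fderiv_single_eq_zero {N : ℕ} (i : Fin N) {w : (Fin N → ℝ) → ℝ}
    {w' : (Fin N → ℝ) → (Fin N → ℝ) →L[ℝ] ℝ}
    (hw : ∀ y ∈ euclideanUnitBall N, HasFDerivAt w (w' y) y)
    (hw' : ContinuousOn (fun y => w' y (Pi.single i 1)) (euclideanUnitBall N))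
    (hbd : ∀ y, ∑ j, y j ^ 2 = 1 → w y = 0) :
    ∫ y in euclideanUnitBall N, w' y (Pi.single i 1) = 0 := by
  obtain _ | n := N
  · exact i.elim0
  set B := euclideanUnitBall (n + 1)
  have hB : MeasurableSet B := (isCompact_euclideanUnitBall _).measurableSet
  set F : (Fin (n + 1) → ℝ) → ℝ := B.indicator fun y => w' y (Pi.single i 1) with hF
  have hFint : Integrable F := by
    rw [hF, integrable_indicator_iff hB]
    exact hw'.integrableOn_compact (isCompact_euclideanUnitBall _)
  have hmp := (volume_preserving_piFinSuccAbove (fun _ : Fin (n + 1) => ℝ) i).symm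
  rw [← integral_indicator hB, ← hmp.integral_comp' F]
  have hint := (hmp.integrable_comp_emb (MeasurableEquiv.measurableEmbedding _)).2 hFint
  refine (integral_prod_symm _ hint).trans ?_
  refine integral_eq_zero_of_ae (Filter.Eventually.of_forall fun z => ?_)
  have hmem : ∀ s : ℝ, i.insertNth s z ∈ B ↔ s ^ 2 + ∑ j, z j ^ 2 ≤ 1 := fun s => by
    simp [B, euclideanUnitBall, Fin.sum_univ_succAbove _ i]
  have hline : ∀ s, HasDerivAt (fun s : ℝ => (i.insertNth s z : Fin (n + 1) → ℝ))
      (Pi.single i 1) s := fun s => by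
    rw [hasDerivAt_pi]
    refine i.forall_iff_succAbove.2 ⟨?_, fun j => ?_⟩
    · simpa using hasDerivAt_id' s
    · simpa using hasDerivAt_const s (z j)
  show ∫ s : ℝ, F (i.insertNth s z) = 0
  rcases lt_or_ge 1 (∑ j, z j ^ 2) with hz | hz
  · have : ∀ s : ℝ, F (i.insertNth s z) = 0 := fun s =>
      indicator_of_notMem (fun h => by have := (hmem s).1 h; nlinarith [sq_nonneg s]) _
    simp [this]
  set r := √(1 - ∑ j, z j ^ 2) with hr
  have hr2 : r ^ 2 = 1 - ∑ j, z j ^ 2 := Real.sq_sqrt (by linarith)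
  have hr0 : 0 ≤ r := Real.sqrt_nonneg _
  have hmem' : ∀ s : ℝ, i.insertNth s z ∈ B ↔ s ∈ Icc (-r) r := fun s => by
    rw [hmem, mem_Icc, ← abs_le, ← sq_le_sq₀ (abs_nonneg s) hr0, sq_abs, hr2]
    constructor <;> intro h <;> linarith
  have hFs : (fun s : ℝ => F (i.insertNth s z)) =
      (Icc (-r) r).indicator fun s => w' (i.insertNth s z) (Pi.single i 1) := by
    funext s
    by_cases hs : s ∈ Icc (-r) r
    · rw [indicator_of_mem hs, hF, indicator_of_mem ((hmem' s).2 hs)]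
    · rw [indicator_of_notMem hs, hF, indicator_of_notMem (mt (hmem' s).1 hs)]
  rw [hFs, integral_indicator measurableSet_Icc, integral_Icc_eq_integral_Ioc,
    ← intervalIntegral.integral_of_le (by linarith)]
  have hcont : Continuous fun s : ℝ => (i.insertNth s z : Fin (n + 1) → ℝ) :=
    continuous_iff_continuousAt.2 fun s => (hline s).continuousAt
  have hend : ∀ s : ℝ, s ^ 2 = r ^ 2 → w (i.insertNth s z) = 0 := fun s hs =>
    hbd _ (by simp [Fin.sum_univ_succAbove _ i, hs, hr2])
  rw [intervalIntegral.integral_eq_sub_of_hasDerivAt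
    (f := fun s => w (i.insertNth s z)), hend r rfl, hend (-r) (by ring), sub_zero]
  · intro s hs
    rw [uIcc_of_le (by linarith)] at hs
    exact (hw _ ((hmem' s).2 hs)).comp_hasDerivAt s (hline s)
  · refine ContinuousOn.intervalIntegrable ?_
    rw [uIcc_of_le (by linarith)]
    exact hw'.comp hcont.continuousOn fun s hs => (hmem' s).2 hs

end UnitBall

section NewtonKernel

variable {N : ℕ}

/-- The Newtonian kernel `|z|^(2-N)` on `ℝᴺ`, as a real power of the sum of squares. -/
noncomputable def newtonKernel (N : ℕ) (z : Fin N → ℝ) : ℝ :=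
  (∑ j, z j ^ 2) ^ (1 - (N : ℝ) / 2)

theorem sqrt_sum_sq_zpow_eq_newtonKernel (z : Fin N → ℝ) :
    √(∑ j, z j ^ 2) ^ (2 - (N : ℤ)) = newtonKernel N z := by
  rw [newtonKernel, Real.sqrt_eq_rpow, ← Real.rpow_intCast,
    ← Real.rpow_mul (Finset.sum_nonneg fun j _ => sq_nonneg _)]
  congr 1
  push_cast
  ring

theorem newtonKernel_sub_comm (x y : Fin N → ℝ) :
    newtonKernel N (x - y) = newtonKernel N (y - x) := by
  simp only [newtonKernel, Pi.sub_apply, sub_sq_comm]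

theorem sum_sq_pos_s16 {z : Fin N → ℝ} (hz : z ≠ 0) : 0 < ∑ j, z j ^ 2 := by
  obtain ⟨j, hj⟩ := Function.ne_iff.1 hz
  exact Finset.sum_pos' (fun j _ => sq_nonneg _) ⟨j, Finset.mem_univ j, by
    have : z j ≠ 0 := hj
    positivity⟩

theorem contDiffOn_newtonKernel {n : WithTop ℕ∞} : ContDiffOn ℝ n (newtonKernel N) {0}ᶜ := by
  intro z hz
  refine ContDiffAt.contDiffWithinAt ?_
  exact ContDiffAt.rpow_const_of_ne (by fun_prop) (sum_sq_pos_s16 hz).ne'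

theorem hasFDerivAt_sum_sq (z : Fin N → ℝ) :
    HasFDerivAt (fun z : Fin N → ℝ => ∑ j, z j ^ 2)
      (∑ j, (2 * z j) • ContinuousLinearMap.proj (R := ℝ) (φ := fun _ : Fin N => ℝ) j) z := by
  refine HasFDerivAt.fun_sum fun j _ => ?_
  simpa using ((ContinuousLinearMap.proj (R := ℝ) (φ := fun _ : Fin N => ℝ) j).hasFDerivAt
    (x := z)).pow 2

theorem fderiv_sum_sq_rpow_single {z : Fin N → ℝ} (hz : z ≠ 0) (p : ℝ) (i : Fin N) :
    fderiv ℝ (fun z : Fin N → ℝ => (∑ j, z j ^ 2) ^ p) z (Pi.single i 1) =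
      2 * p * z i * (∑ j, z j ^ 2) ^ (p - 1) := by
  rw [((hasFDerivAt_sum_sq z).rpow_const (Or.inl (sum_sq_pos_s16 hz).ne')).fderiv]
  simp [Pi.single_apply]
  ring

theorem lap_newtonKernel {z : Fin N → ℝ} (hz : z ≠ 0) : lap (newtonKernel N) z = 0 := by
  set p : ℝ := 1 - (N : ℝ) / 2 with hp
  have hQ := sum_sq_pos_s16 hz
  have hi : ∀ i : Fin N, fderiv ℝ (fun y => fderiv ℝ (newtonKernel N) y (Pi.single i 1)) z
      (Pi.single i 1) = 2 * p * (∑ j, z j ^ 2) ^ (p - 1) +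
        4 * p * (p - 1) * (∑ j, z j ^ 2) ^ (p - 1 - 1) * z i ^ 2 := fun i => by
    have heq : (fun y => fderiv ℝ (newtonKernel N) y (Pi.single i 1)) =ᶠ[𝓝 z]
        fun y => (2 * p * y i) * (∑ j, y j ^ 2) ^ (p - 1) := by
      filter_upwards [isOpen_ne.mem_nhds hz] with y hy
      exact fderiv_sum_sq_rpow_single hy p i
    rw [heq.fderiv_eq, fderiv_fun_mul (by fun_prop)
      ((hasFDerivAt_sum_sq z).rpow_const (Or.inl hQ.ne')).differentiableAt]
    have h1 : fderiv ℝ (fun y : Fin N → ℝ => 2 * p * y i) z (Pi.single i 1) = 2 * p := by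
      rw [((hasFDerivAt_apply i z).const_mul (2 * p)).fderiv]
      simp
    simp only [add_apply, smul_apply, smul_eq_mul, h1,
      fderiv_sum_sq_rpow_single hz]
    ring
  rw [lap, Finset.sum_congr rfl fun i _ => hi i, Finset.sum_add_distrib, ← Finset.mul_sum,
    Finset.sum_const, Finset.card_univ, Fintype.card_fin, nsmul_eq_mul, ← Finset.mul_sum,
    mul_assoc _ _ (∑ j, z j ^ 2), ← Real.rpow_add_one hQ.ne', sub_add_cancel, hp]
  ring

end NewtonKernel

section DiagonalImage

variable {N : ℕ}

theorem isOpen_compl_image_mul_euclideanUnitBall (τ : Fin N → ℝ) :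
    IsOpen ((fun y => τ * y) '' euclideanUnitBall N)ᶜ :=
  ((isCompact_euclideanUnitBall N).image (by fun_prop)).isClosed.isOpen_compl

theorem hasFDerivAt_setIntegral_sub_mul {f : (Fin N → ℝ) → ℝ} (hf : ContDiffOn ℝ 1 f {0}ᶜ)
    (τ : Fin N → ℝ) {x : Fin N → ℝ} (hx : x ∈ ((fun y => τ * y) '' euclideanUnitBall N)ᶜ) :
    HasFDerivAt (fun x => ∫ y in euclideanUnitBall N, f (x - τ * y))
      (∫ y in euclideanUnitBall N, fderiv ℝ f (x - τ * y)) x := by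
  have hmaps : MapsTo (fun q : (Fin N → ℝ) × (Fin N → ℝ) => q.1 - τ * q.2)
      (((fun y => τ * y) '' euclideanUnitBall N)ᶜ ×ˢ euclideanUnitBall N) {0}ᶜ :=
    fun q hq h => hq.1 ⟨q.2, hq.2, (sub_eq_zero.1 h).symm⟩
  refine hasFDerivAt_setIntegral_of_continuousOn (isOpen_compl_image_mul_euclideanUnitBall τ)
    (isCompact_euclideanUnitBall N) (G := fun x y => f (x - τ * y))
    (G' := fun x y => fderiv ℝ f (x - τ * y)) ?_ ?_ ?_ hx
  · exact hf.continuousOn.comp (by fun_prop) hmaps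
  · exact (hf.continuousOn_fderiv_of_isOpen isOpen_compl_singleton le_rfl).comp
      (by fun_prop) hmaps
  · intro x hx y hy
    have h0 : x - τ * y ∈ ({0}ᶜ : Set (Fin N → ℝ)) := hmaps (x := (x, y)) ⟨hx, hy⟩
    exact (hasFDerivAt_comp_sub _).2 (((hf.differentiableOn one_ne_zero).differentiableAt
      (isOpen_compl_singleton.mem_nhds h0)).hasFDerivAt)

theorem fderiv_setIntegral_sub_mul_apply {f : (Fin N → ℝ) → ℝ} (hf : ContDiffOn ℝ 1 f {0}ᶜ)
    (τ : Fin N → ℝ) {x : Fin N → ℝ} (hx : x ∈ ((fun y => τ * y) '' euclideanUnitBall N)ᶜ)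
    (v : Fin N → ℝ) :
    fderiv ℝ (fun x => ∫ y in euclideanUnitBall N, f (x - τ * y)) x v =
      ∫ y in euclideanUnitBall N, fderiv ℝ f (x - τ * y) v := by
  rw [(hasFDerivAt_setIntegral_sub_mul hf τ hx).fderiv, ContinuousLinearMap.integral_apply]
  refine ContinuousOn.integrableOn_compact (isCompact_euclideanUnitBall N) ?_
  refine (hf.continuousOn_fderiv_of_isOpen isOpen_compl_singleton le_rfl).comp
      (by fun_prop) fun y hy h => hx ⟨y, hy, (sub_eq_zero.1 h).symm⟩

theorem contDiffOn_setIntegral_sub_mul (n : ℕ) {f : (Fin N → ℝ) → ℝ}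
    (hf : ContDiffOn ℝ n f {0}ᶜ) (τ : Fin N → ℝ) :
    ContDiffOn ℝ n (fun x => ∫ y in euclideanUnitBall N, f (x - τ * y))
      ((fun y => τ * y) '' euclideanUnitBall N)ᶜ := by
  have hopen := isOpen_compl_image_mul_euclideanUnitBall τ
  induction n generalizing f with
  | zero =>
    rw [Nat.cast_zero, contDiffOn_zero] at hf ⊢
    refine continuousOn_setIntegral_of_isOpen hopen (isCompact_euclideanUnitBall N) ?_
    exact hf.comp (by fun_prop) fun q hq h => hq.1 ⟨q.2, hq.2, (sub_eq_zero.1 h).symm⟩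
  | succ n ih =>
    rw [Nat.cast_succ] at hf ⊢
    have hf1 : ContDiffOn ℝ 1 f {0}ᶜ := hf.of_le le_add_self
    rw [contDiffOn_succ_iff_fderiv_of_isOpen hopen]
    refine ⟨fun x hx => (hasFDerivAt_setIntegral_sub_mul hf1 τ hx).differentiableAt
      |>.differentiableWithinAt, by simp, contDiffOn_clm_apply.2 fun v => ?_⟩
    refine (ih (f := fun z => fderiv ℝ f z v) ?_).congr fun x hx =>
      fderiv_setIntegral_sub_mul_apply hf1 τ hx v
    exact (hf.fderiv_of_isOpen isOpen_compl_singleton le_rfl).clm_apply contDiffOn_const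

theorem lap_setIntegral_sub_mul {f : (Fin N → ℝ) → ℝ} (hf : ContDiffOn ℝ 2 f {0}ᶜ)
    (τ : Fin N → ℝ) {x : Fin N → ℝ} (hx : x ∈ ((fun y => τ * y) '' euclideanUnitBall N)ᶜ) :
    lap (fun x => ∫ y in euclideanUnitBall N, f (x - τ * y)) x =
      ∫ y in euclideanUnitBall N, lap f (x - τ * y) := by
  have hf1 : ContDiffOn ℝ 1 f {0}ᶜ := hf.of_le one_le_two
  have hopen := isOpen_compl_image_mul_euclideanUnitBall τ
  have hfi : ∀ v, ContDiffOn ℝ 1 (fun z => fderiv ℝ f z v) {0}ᶜ := fun v =>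
    (hf.fderiv_of_isOpen isOpen_compl_singleton (by norm_num)).clm_apply contDiffOn_const
  simp only [lap]
  rw [integral_finsetSum]
  · refine Finset.sum_congr rfl fun i _ => ?_
    have heq : (fun x' => fderiv ℝ (fun x => ∫ y in euclideanUnitBall N, f (x - τ * y)) x'
        (Pi.single i 1)) =ᶠ[𝓝 x]
        fun x => ∫ y in euclideanUnitBall N, fderiv ℝ f (x - τ * y) (Pi.single i 1) := by
      filter_upwards [hopen.mem_nhds hx] with x' hx'
      exact fderiv_setIntegral_sub_mul_apply hf1 τ hx' _
    rw [heq.fderiv_eq]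
    exact fderiv_setIntegral_sub_mul_apply (hfi _) τ hx _
  · intro i _
    refine ContinuousOn.integrableOn_compact (isCompact_euclideanUnitBall N) ?_
    have := ((hfi (Pi.single i 1)).continuousOn_fderiv_of_isOpen
      isOpen_compl_singleton le_rfl).clm_apply (continuousOn_const (c := Pi.single i 1))
    exact this.comp (f := fun y => x - τ * y) (by fun_prop)
      fun y hy h => hx ⟨y, hy, (sub_eq_zero.1 h).symm⟩

end DiagonalImage

section ConfocalFamily

variable {N : ℕ}

theorem clm_apply_eq_sum_single (L : (Fin N → ℝ) →L[ℝ] ℝ) (v : Fin N → ℝ) :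
    L v = ∑ j, v j * L (Pi.single j 1) := by
  conv_lhs => rw [pi_eq_sum_univ' v]
  simp [map_sum, Pi.single]

theorem setIntegral_mul_fderiv_single {W : Set (Fin N → ℝ)} (hW : IsOpen W)
    {f : (Fin N → ℝ) → ℝ} (hf : ContDiffOn ℝ 2 f W) {τ : Fin N → ℝ}
    (hτW : ∀ y ∈ euclideanUnitBall N, τ * y ∈ W) (j : Fin N) :
    2 * ∫ y in euclideanUnitBall N, y j * fderiv ℝ f (τ * y) (Pi.single j 1) =
      τ j * ∫ y in euclideanUnitBall N, (1 - ∑ k, y k ^ 2) *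
        fderiv ℝ (fun z => fderiv ℝ f z (Pi.single j 1)) (τ * y) (Pi.single j 1) := by
  have hB := isCompact_euclideanUnitBall N
  set g : (Fin N → ℝ) → ℝ := fun z => fderiv ℝ f z (Pi.single j 1) with hg
  have hg1 : ContDiffOn ℝ 1 g W :=
    (hf.fderiv_of_isOpen hW (by norm_num)).clm_apply contDiffOn_const
  have hmap : ContinuousOn (fun y => τ * y) (euclideanUnitBall N) := by fun_prop
  have hgc : ContinuousOn (fun y => g (τ * y)) (euclideanUnitBall N) :=
    hg1.continuousOn.comp hmap hτW
  have hg'c : ContinuousOn (fun y => fderiv ℝ g (τ * y) (Pi.single j 1))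
      (euclideanUnitBall N) :=
    ((hg1.continuousOn_fderiv_of_isOpen hW le_rfl).comp hmap hτW).clm_apply continuousOn_const
  have hmul : ∀ y, HasFDerivAt (fun y => τ * y) (ContinuousLinearMap.mul ℝ (Fin N → ℝ) τ) y :=
    fun y => (ContinuousLinearMap.mul ℝ (Fin N → ℝ) τ).hasFDerivAt
  have hgd : ∀ y ∈ euclideanUnitBall N, HasFDerivAt (fun y => g (τ * y))
      ((fderiv ℝ g (τ * y)).comp (ContinuousLinearMap.mul ℝ (Fin N → ℝ) τ)) y := fun y hy =>
    (((hg1.differentiableOn one_ne_zero).differentiableAt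
      (hW.mem_nhds (hτW y hy))).hasFDerivAt).comp y (hmul y)
  have hτj : τ * Pi.single j 1 = τ j • Pi.single j (1 : ℝ) := by
    ext k
    by_cases h : k = j
    · subst h; simp
    · simp [h]
  have hval : ∀ y, ((1 - ∑ k, y k ^ 2) •
      (fderiv ℝ g (τ * y)).comp (ContinuousLinearMap.mul ℝ (Fin N → ℝ) τ) +
      g (τ * y) • -(∑ k, (2 * y k) •
        ContinuousLinearMap.proj (R := ℝ) (φ := fun _ : Fin N => ℝ) k)) (Pi.single j 1) =
      τ j * ((1 - ∑ k, y k ^ 2) * fderiv ℝ g (τ * y) (Pi.single j 1)) -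
        2 * (y j * g (τ * y)) := fun y => by
    simp [hτj, Pi.single_apply]
    ring
  have hc₁ : ContinuousOn (fun y => τ j * ((1 - ∑ k, y k ^ 2) *
      fderiv ℝ g (τ * y) (Pi.single j 1))) (euclideanUnitBall N) :=
    continuousOn_const.mul
      ((show Continuous fun y : Fin N → ℝ => 1 - ∑ k, y k ^ 2 by fun_prop).continuousOn.mul hg'c)
  have hc₂ : ContinuousOn (fun y => 2 * (y j * g (τ * y))) (euclideanUnitBall N) :=
    continuousOn_const.mul ((continuous_apply j).continuousOn.mul hgc)
  have hdiv := setIntegral_fderiv_single_eq_zero j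
    (w := fun y => (1 - ∑ k, y k ^ 2) * g (τ * y))
    (fun y hy => ((hasFDerivAt_sum_sq y).const_sub 1).mul (hgd y hy))
    (by simpa only [hval] using hc₁.fun_sub hc₂) (fun y hy => by simp [hy])
  simp only [hval] at hdiv
  rw [integral_sub, integral_const_mul, integral_const_mul, sub_eq_zero] at hdiv
  · exact hdiv.symm
  · exact hc₁.integrableOn_compact hB
  · exact hc₂.integrableOn_compact hB

theorem setIntegral_fderiv_confocal_eq_zero {W : Set (Fin N → ℝ)} (hW : IsOpen W)
    {f : (Fin N → ℝ) → ℝ} (hf : ContDiffOn ℝ 2 f W) (hlap : ∀ z ∈ W, lap f z = 0)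
    {τ : Fin N → ℝ} (hτ : ∀ j, τ j ≠ 0) (hτW : ∀ y ∈ euclideanUnitBall N, τ * y ∈ W) (c : ℝ) :
    ∫ y in euclideanUnitBall N, fderiv ℝ f (τ * y) ((fun j => c / τ j) * y) = 0 := by
  have hB := isCompact_euclideanUnitBall N
  have hmap : ContinuousOn (fun y => τ * y) (euclideanUnitBall N) := by fun_prop
  have hc1 : ∀ v, ContinuousOn (fun y => fderiv ℝ f (τ * y) v) (euclideanUnitBall N) := fun v =>
    ((hf.continuousOn_fderiv_of_isOpen hW one_le_two).comp hmap hτW).clm_apply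
      continuousOn_const
  have hc2 : ∀ v, ContinuousOn (fun y => fderiv ℝ (fun z => fderiv ℝ f z v) (τ * y) v)
      (euclideanUnitBall N) := fun v =>
    ((((hf.fderiv_of_isOpen hW (m := 1) (by norm_num)).clm_apply
      contDiffOn_const).continuousOn_fderiv_of_isOpen hW le_rfl).comp hmap hτW).clm_apply
        continuousOn_const
  have hterm : ∀ j, ∫ y in euclideanUnitBall N,
      ((fun j => c / τ j) * y) j * fderiv ℝ f (τ * y) (Pi.single j 1) =
      c / 2 * ∫ y in euclideanUnitBall N, (1 - ∑ k, y k ^ 2) *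
        fderiv ℝ (fun z => fderiv ℝ f z (Pi.single j 1)) (τ * y) (Pi.single j 1) := fun j => by
    have h := setIntegral_mul_fderiv_single hW hf hτW j
    simp only [Pi.mul_apply, mul_assoc]
    rw [integral_const_mul]
    have := hτ j
    field_simp
    linear_combination c * h
  simp_rw [clm_apply_eq_sum_single (fderiv ℝ f _) (_ * _)]
  rw [integral_finsetSum _ fun j _ => ContinuousOn.integrableOn_compact hB
      (by have := hc1 (Pi.single j 1); simp only [Pi.mul_apply]; fun_prop),
    Finset.sum_congr rfl fun j _ => hterm j, ← Finset.mul_sum, ← integral_finsetSum]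
  · rw [setIntegral_congr_fun hB.measurableSet (g := fun _ => (0 : ℝ)) fun y hy => by
      have := hlap _ (hτW y hy)
      simp only [lap] at this
      simp only [← Finset.mul_sum, this, mul_zero]]
    simp
  · intro j _
    exact ContinuousOn.integrableOn_compact hB
      (by have := hc2 (Pi.single j 1); fun_prop)

/-- If `τ` has derivative `c / τ`, so that the ellipsoids `τ t * B` are confocal, then the averages
of a harmonic function over `τ t * B` agree at both ends, even when the ellipsoid degenerates there. -/
theorem setIntegral_confocal_endpoints_eq {W : Set (Fin N → ℝ)} (hW : IsOpen W)
    {f : (Fin N → ℝ) → ℝ} (hf : ContDiffOn ℝ 2 f W) (hlap : ∀ z ∈ W, lap f z = 0)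
    {τ : ℝ → Fin N → ℝ} {c : ℝ} (hτc : ContinuousOn τ (Icc 0 1))
    (hτ : ∀ t ∈ Ioo (0 : ℝ) 1, ∀ j, τ t j ≠ 0)
    (hτ' : ∀ t ∈ Ioo (0 : ℝ) 1, HasDerivAt τ (fun j => c / τ t j) t)
    (hτW : ∀ t ∈ Icc (0 : ℝ) 1, ∀ y ∈ euclideanUnitBall N, τ t * y ∈ W) :
    ∫ y in euclideanUnitBall N, f (τ 1 * y) = ∫ y in euclideanUnitBall N, f (τ 0 * y) := by
  have hB := isCompact_euclideanUnitBall N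
  have hmap : ContinuousOn (fun q : ℝ × (Fin N → ℝ) => τ q.1 * q.2)
      (Icc 0 1 ×ˢ euclideanUnitBall N) :=
    (hτc.comp continuousOn_fst fun q hq => hq.1).mul continuousOn_snd
  have hG : ContinuousOn (fun q : ℝ × (Fin N → ℝ) => f (τ q.1 * q.2))
      (Icc 0 1 ×ˢ euclideanUnitBall N) :=
    hf.continuousOn.comp hmap fun q hq => hτW _ hq.1 _ hq.2
  have hsub : Ioo (0 : ℝ) 1 ×ˢ euclideanUnitBall N ⊆ Icc 0 1 ×ˢ euclideanUnitBall N :=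
    prod_mono Ioo_subset_Icc_self subset_rfl
  have hf' : ContinuousOn (fun q : ℝ × (Fin N → ℝ) => fderiv ℝ f (τ q.1 * q.2))
      (Ioo 0 1 ×ˢ euclideanUnitBall N) :=
    (hf.continuousOn_fderiv_of_isOpen hW one_le_two).comp (hmap.mono hsub)
      fun q hq => hτW _ (Ioo_subset_Icc_self hq.1) _ hq.2
  have hσ : ContinuousOn (fun q : ℝ × (Fin N → ℝ) => (fun j => c / τ q.1 j) * q.2)
      (Ioo 0 1 ×ˢ euclideanUnitBall N) := by
    refine ContinuousOn.mul (continuousOn_pi.2 fun j => ?_) continuousOn_snd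
    refine continuousOn_const.div ?_ fun q hq => hτ _ hq.1 j
    exact (continuousOn_pi.1 (hτc.mono Ioo_subset_Icc_self) j).comp continuousOn_fst
      fun q hq => hq.1
  have hG' : ContinuousOn (fun q : ℝ × (Fin N → ℝ) => ContinuousLinearMap.toSpanSingleton ℝ
      (fderiv ℝ f (τ q.1 * q.2) ((fun j => c / τ q.1 j) * q.2)))
      (Ioo 0 1 ×ˢ euclideanUnitBall N) :=
    (ContinuousLinearMap.toSpanSingletonCLE (𝕜 := ℝ) (E := ℝ)).continuous.comp_continuousOn
      (hf'.clm_apply hσ)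
  have hderiv : ∀ t ∈ Ioo (0 : ℝ) 1,
      HasDerivAt (fun t => ∫ y in euclideanUnitBall N, f (τ t * y)) 0 t := fun t ht => by
    have h := (hasFDerivAt_setIntegral_of_continuousOn (μ := volume) isOpen_Ioo hB
      (G := fun t y => f (τ t * y)) (G' := fun t y => ContinuousLinearMap.toSpanSingleton ℝ
        (fderiv ℝ f (τ t * y) ((fun j => c / τ t j) * y))) (hG.mono hsub) hG'
          (fun t ht y hy => ?_) ht).hasDerivAt
    · rw [ContinuousLinearMap.integral_apply] at h
      · simpa [setIntegral_fderiv_confocal_eq_zero hW hf hlap (hτ t ht)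
          (hτW t (Ioo_subset_Icc_self ht)) c] using h
      · exact ContinuousOn.integrableOn_compact hB
          (hG'.comp (f := fun y => (t, y)) (by fun_prop) fun y hy => ⟨ht, hy⟩)
    · have hz := hτW t (Ioo_subset_Icc_self ht) y hy
      exact HasDerivAt.hasFDerivAt <|
        (((hf.differentiableOn two_ne_zero).differentiableAt
          (hW.mem_nhds hz)).hasFDerivAt).comp_hasDerivAt t ((hτ' t ht).mul_const y)
  obtain ⟨t, -, ht⟩ := exists_hasDerivAt_eq_slope _ _ zero_lt_one
    (continuousOn_setIntegral_of_isCompact (μ := volume) isCompact_Icc hB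
      (G := fun t y => f (τ t * y)) hG) hderiv
  rw [sub_zero, div_one] at ht
  exact (sub_eq_zero.1 ht.symm)

end ConfocalFamily

theorem lap_const_mul {N : ℕ} (C : ℝ) (f : (Fin N → ℝ) → ℝ) (x : Fin N → ℝ) :
    lap (fun x => C * f x) x = C * lap f x := by
  have h : ∀ (g : (Fin N → ℝ) → ℝ) (y v : Fin N → ℝ),
      fderiv ℝ (fun x => C * g x) y v = C * fderiv ℝ g y v := fun g y v => by
    have := congrArg (fun L : (Fin N → ℝ) →L[ℝ] ℝ => L v)
      (congrFun (fderiv_const_smul_field (𝕜 := ℝ) (f := g) C) y)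
    simpa [Pi.smul_def] using this
  simp only [lap, h, Finset.mul_sum]

theorem lap_comp_sub {N : ℕ} (f : (Fin N → ℝ) → ℝ) (x z : Fin N → ℝ) :
    lap (fun z => f (z - x)) z = lap f (z - x) := by
  simp only [lap, fderiv_comp_sub]
  exact Finset.sum_congr rfl fun i _ => by
    rw [fderiv_comp_sub (f := fun y => fderiv ℝ f y (Pi.single i 1))]

theorem exists_setIntegral_image_mul_eq {N : ℕ} {a : Fin N → ℝ} (ha : ∀ j, a j ≠ 0) :
    ∃ C : ℝ, ∀ g : (Fin N → ℝ) → ℝ,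
      ∫ y in {x : Fin N → ℝ | ∑ j, x j ^ 2 / a j ^ 2 ≤ 1}, g y =
        C * ∫ y in euclideanUnitBall N, g (a * y) := by
  have himage : {x : Fin N → ℝ | ∑ j, x j ^ 2 / a j ^ 2 ≤ 1} =
      (ContinuousLinearMap.mul ℝ (Fin N → ℝ) a) '' euclideanUnitBall N := by
    ext x
    constructor
    · intro hx
      refine ⟨x / a, ?_, ?_⟩
      · simpa [euclideanUnitBall, div_pow] using hx
      · ext j
        simp [mul_div_cancel₀ _ (ha j)]
    · rintro ⟨y, hy, rfl⟩
      have : ∀ j, a j ^ 2 * y j ^ 2 / a j ^ 2 = y j ^ 2 := fun j => by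
        have := ha j
        field_simp
      have hy : ∑ j, y j ^ 2 ≤ 1 := hy
      simpa [mul_pow, this] using hy
  refine ⟨|(ContinuousLinearMap.mul ℝ (Fin N → ℝ) a).det|, fun g => ?_⟩
  rw [himage, integral_image_eq_integral_abs_det_fderiv_smul volume
    (isCompact_euclideanUnitBall N).measurableSet
    (fun y _ => (ContinuousLinearMap.mul ℝ (Fin N → ℝ) a).hasFDerivAt.hasFDerivWithinAt)]
  · simp [integral_const_mul]
  · intro y _ z _ h
    ext j
    simpa [ha j] using congrFun h j

/-- **Corollary 2.5** (single-valued form): the exterior Newtonian potential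
`u_Ω(x) = ∫_Ω |x−y|^{2−N} dy` of the ellipsoid `Ω = {x : Σ xⱼ²/aⱼ² ≤ 1}`
(`a₁ > ⋯ > a_N > 0`, `N ≥ 3`) extends harmonically across `∂Ω` into all of `ℝᴺ \ E`,
where `E = {y : y_N = 0, Σ_{j<N} yⱼ²/(aⱼ²−a_N²) ≤ 1}` is the focal ellipsoid. -/
theorem exterior_potential_extends_harmonically_off_focal_ellipsoid
    (N : ℕ) (hN : 3 ≤ N) (a : Fin N → ℝ) (hpos : ∀ j, 0 < a j)
    (hstrict : ∀ i j : Fin N, i < j → a j < a i) :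
    let lN : Fin N := ⟨N - 1, by omega⟩
    let cast : Fin (N - 1) → Fin N := Fin.castLE (by omega)
    let E : Set (Fin N → ℝ) :=
      {y | y lN = 0 ∧ ∑ j, (y (cast j)) ^ 2 / ((a (cast j)) ^ 2 - (a lN) ^ 2) ≤ 1}
    let Ω : Set (Fin N → ℝ) := {x | ∑ j, (x j) ^ 2 / (a j) ^ 2 ≤ 1}
    ∃ h : (Fin N → ℝ) → ℝ,
      (ContDiffOn ℝ 2 h Eᶜ ∧ ∀ x ∈ (Eᶜ : Set (Fin N → ℝ)), lap h x = 0) ∧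
      ∀ x ∉ closure Ω,
        h x = ∫ y in Ω, Real.sqrt (∑ j, (x j - y j) ^ 2) ^ (2 - (N : ℤ)) := by
  intro lN cast E Ω
  obtain ⟨C, hC⟩ := exists_setIntegral_image_mul_eq fun j => (hpos j).ne'
  set τ : ℝ → Fin N → ℝ := fun t j => √(a j ^ 2 - a lN ^ 2 * t) with hτ
  have hlast : ∀ j, a lN ≤ a j := fun j => by
    rcases (show j ≤ lN from Fin.le_def.2 (Nat.le_sub_one_of_lt j.2)).lt_or_eq with h | h
    · exact (hstrict _ _ h).le
    · rw [h]
  have hlt : ∀ j : Fin (N - 1), a lN < a (cast j) := fun j => hstrict _ _ (Fin.lt_def.2 j.2)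
  have hτ0 : τ 0 = a := by
    ext j
    simp [hτ, Real.sqrt_sq (hpos j).le]
  have hτlast : τ 1 lN = 0 := by simp [hτ]
  have hτcast : ∀ j, τ 1 (cast j) ^ 2 = a (cast j) ^ 2 - a lN ^ 2 := fun j => by
    simp only [hτ, mul_one]
    exact Real.sq_sqrt (sub_nonneg.2 (pow_le_pow_left₀ (hpos _).le (hlt j).le 2))
  have hgap : ∀ j, 0 < a (cast j) ^ 2 - a lN ^ 2 := fun j =>
    sub_pos.2 (pow_lt_pow_left₀ (hlt j) (hpos _).le two_ne_zero)
  have hEimage : (fun y => τ 1 * y) '' euclideanUnitBall N ⊆ E := by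
    rintro _ ⟨y, hy, rfl⟩
    refine ⟨by simp [hτlast], le_trans ?_ hy⟩
    have hterm : ∀ j, (τ 1 * y) (cast j) ^ 2 / (a (cast j) ^ 2 - a lN ^ 2) = y (cast j) ^ 2 :=
      fun j => by
        rw [Pi.mul_apply, mul_pow, hτcast, mul_div_cancel_left₀ _ (hgap j).ne']
    rw [Finset.sum_congr rfl fun j _ => hterm j]
    calc ∑ j, y (cast j) ^ 2
        = ∑ k ∈ Finset.univ.map (Fin.castLEEmb (show N - 1 ≤ N by omega)), y k ^ 2 := by
          rw [Finset.sum_map]; rfl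
      _ ≤ ∑ k, y k ^ 2 :=
        Finset.sum_le_sum_of_subset_of_nonneg (Finset.subset_univ _) fun k _ _ => sq_nonneg _
  have hτΩ : ∀ t ∈ Icc (0 : ℝ) 1, ∀ y ∈ euclideanUnitBall N, τ t * y ∈ Ω := by
    intro t ht y hy
    refine le_trans (b := ∑ j, y j ^ 2) (Finset.sum_le_sum fun j _ => ?_) hy
    have ha := hpos j
    have hsq : τ t j ^ 2 ≤ a j ^ 2 := by
      rw [← sq_abs (a j), ← sq_abs (τ t j), abs_of_nonneg (Real.sqrt_nonneg _), abs_of_pos ha]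
      refine pow_le_pow_left₀ (Real.sqrt_nonneg _) (Real.sqrt_le_iff.2 ⟨ha.le, ?_⟩) 2
      have : 0 ≤ a lN ^ 2 * t := mul_nonneg (sq_nonneg _) ht.1
      linarith
    rw [Pi.mul_apply, mul_pow, div_le_iff₀ (by positivity), mul_comm]
    exact mul_le_mul_of_nonneg_left hsq (sq_nonneg _)
  have hradicand : ∀ t ∈ Ioo (0 : ℝ) 1, ∀ j, 0 < a j ^ 2 - a lN ^ 2 * t := fun t ht j => by
    have h₁ := pow_le_pow_left₀ (hpos lN).le (hlast j) 2
    have h₂ : 0 < a lN ^ 2 := pow_pos (hpos lN) 2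
    nlinarith [ht.2]
  have hK2 : ContDiffOn ℝ 2 (newtonKernel N) {0}ᶜ := contDiffOn_newtonKernel
  have hsubset : Eᶜ ⊆ ((fun y => τ 1 * y) '' euclideanUnitBall N)ᶜ :=
    compl_subset_compl.2 hEimage
  have hsmooth := (contDiffOn_setIntegral_sub_mul 2 hK2 (τ 1)).mono hsubset
  have hzero : ∀ x ∈ Eᶜ,
      lap (fun x => ∫ y in euclideanUnitBall N, newtonKernel N (x - τ 1 * y)) x = 0 := by
    intro x hx
    rw [lap_setIntegral_sub_mul hK2 (τ 1) (hsubset hx),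
      setIntegral_congr_fun (isCompact_euclideanUnitBall N).measurableSet
        (g := fun _ => (0 : ℝ)) fun y hy => lap_newtonKernel fun h =>
          hsubset hx ⟨y, hy, (sub_eq_zero.1 h).symm⟩]
    simp
  refine ⟨fun x => C * ∫ y in euclideanUnitBall N, newtonKernel N (x - τ 1 * y),
    ⟨contDiffOn_const.mul hsmooth, fun x hx => ?_⟩, fun x hx => ?_⟩
  · rw [lap_const_mul, hzero x hx, mul_zero]
  have hxΩ : x ∉ Ω := fun h => hx (subset_closure h)
  have hkernel : ∀ y, √(∑ j, (x j - y j) ^ 2) ^ (2 - (N : ℤ)) = newtonKernel N (y - x) :=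
    fun y => by
      rw [newtonKernel_sub_comm]
      exact sqrt_sum_sq_zpow_eq_newtonKernel (x - y)
  simp_rw [hkernel, newtonKernel_sub_comm x]
  rw [hC]
  congr 1
  have hcomp : ContDiffOn ℝ 2 (fun z => newtonKernel N (z - x)) {x}ᶜ :=
    hK2.comp (by fun_prop) fun z hz h => hz (sub_eq_zero.1 h)
  have hends := setIntegral_confocal_endpoints_eq (τ := τ) (c := -a lN ^ 2 / 2)
    isOpen_compl_singleton hcomp
    (fun z hz => by rw [lap_comp_sub, lap_newtonKernel (sub_ne_zero.2 hz)])
    (by fun_prop) (fun t ht j => (Real.sqrt_pos.2 (hradicand t ht j)).ne') (fun t ht => ?_)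
    (fun t ht y hy h => hxΩ (h ▸ hτΩ t ht y hy))
  · rwa [hτ0] at hends
  · refine hasDerivAt_pi.2 fun j => ?_
    convert! (((hasDerivAt_id t).const_mul (a lN ^ 2)).const_sub (a j ^ 2)).sqrt
      (hradicand t ht j).ne' using 1
    simp only [hτ, id, mul_one]
    rw [div_div]
end
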